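/- Let (fᵢ) be a sequence of expanding maps on [0,1), each generating a full shift with bounded distortion, and assume each fᵢ satisfies: for each m there is p̄ with dim_H(G^{fᵢ,m}_{p̄}) = 1, and for each word w of length m there are vectors q̄ with q_w ≠ p_w and dim_H(G^{fᵢ,m}_{q̄}) arbitrarily close to 1. Then the set of x ∈ [0,1) that are not m-normal to any fᵢ for any m ∈ ℕ has Hausdorff dimension 1. -/

import Mathlib

open Set MeasureTheory Filter
open scoped ENNReal Classical

noncomputable section

/-- A similarity transformation of `ℝ`. -/
def IsSimilarity (f : ℝ → ℝ) : Prop := ∃ a b : ℝ, a ≠ 0 ∧ ∀ x, f x = a * x + b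

/-- Falconer's class `𝒢^s`: Gδ sets all of whose images under countably many
similarities intersect in a set of Hausdorff dimension at least `s`. -/
def falconerClass (s : ℝ) : Set (Set ℝ) :=
  {F | IsGδ F ∧ ∀ T : ℕ → ℝ → ℝ, (∀ i, IsSimilarity (T i)) →
    ENNReal.ofReal s ≤ dimH (⋂ i, T i '' F)}

/-- A probability vector indexed by a finite type. -/
def IsProbVector {ι : Type*} [Fintype ι] (p : ι → ℝ) : Prop :=
  (∀ i, 0 ≤ p i) ∧ ∑ i, p i = 1

/-- A dyadic half-open interval `[2^k m, 2^k (m+1))`. -/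
def IsDyadic (I : Set ℝ) : Prop :=
  ∃ (k m : ℤ), I = Ico ((2:ℝ) ^ k * m) ((2:ℝ) ^ k * (m + 1))

/-- The outer measure `M^s_∞` obtained from countable covers by dyadic intervals. -/
def dyadicMeasure (s : ℝ) (A : Set ℝ) : ℝ≥0∞ :=
  ⨅ (I : ℕ → Set ℝ) (_ : ∀ i, IsDyadic (I i)) (_ : A ⊆ ⋃ i, I i),
    ∑' i, volume (I i) ^ s

/-- Extension of a subset of `[0,1)` to `ℝ` by integer translations. -/
def periodize (A : Set ℝ) : Set ℝ := ⋃ k : ℤ, (fun x => x + (k : ℝ)) '' A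

/-- An expanding interval map on `[0,1)` with `g` full monotone branches,
generating a full shift on `g` symbols. -/
structure ExpandingFullShift where
  g : ℕ
  one_lt_g : 1 < g
  branch : Fin g → Set ℝ
  branch_Ico : ∀ i, ∃ a b : ℝ, a < b ∧ branch i = Ico a b
  branch_cover : (⋃ i, branch i) = Ico (0:ℝ) 1
  branch_disjoint : ∀ i j, i ≠ j → Disjoint (branch i) (branch j)
  f : ℝ → ℝ
  f_onto : ∀ i, f '' branch i = Ico (0:ℝ) 1
  f_mono : ∀ i, StrictMonoOn f (branch i) ∨ StrictAntiOn f (branch i)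
  f_expanding : ∀ i, ∀ x ∈ branch i, ∀ y ∈ branch i, |x - y| ≤ |f x - f y|

namespace ExpandingFullShift

variable (E : ExpandingFullShift)

/-- The symbol `0`. -/
def zeroSym : Fin E.g := ⟨0, Nat.lt_trans Nat.one_pos E.one_lt_g⟩

/-- The cylinder `C_{x₁ … x_n} ⊆ [0,1)` determined by a word `w`. -/
def cylinder (w : List (Fin E.g)) : Set ℝ :=
  {x ∈ Ico (0:ℝ) 1 | ∀ k (hk : k < w.length), E.f^[k] x ∈ E.branch (w.get ⟨k, hk⟩)}

/-- A cylinder in some interval `[k, k+1)`, `k ∈ ℤ` (periodic extension of the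
cylinder structure to `ℝ`). -/
def IsCylinderZ (C : Set ℝ) : Prop :=
  ∃ (w : List (Fin E.g)) (k : ℤ), C = (fun x => x + (k : ℝ)) '' E.cylinder w

/-- The outer measure `N^s_∞` obtained from countable covers by cylinders of `E`. -/
def cylMeasure (s : ℝ) (A : Set ℝ) : ℝ≥0∞ :=
  ⨅ (c : ℕ → List (Fin E.g)) (_ : A ⊆ ⋃ i, E.cylinder (c i)),
    ∑' i, volume (E.cylinder (c i)) ^ s

/-- The outer measure `N^s_∞` from covers by cylinders of the periodic extension. -/
def cylMeasureZ (s : ℝ) (A : Set ℝ) : ℝ≥0∞ :=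
  ⨅ (c : ℕ → Set ℝ) (_ : ∀ i, E.IsCylinderZ (c i)) (_ : A ⊆ ⋃ i, c i),
    ∑' i, volume (c i) ^ s

/-- The empirical frequency `τ^f_w(x,n)/(n-m)` of the word `w` (of length `m`)
in the first `n` symbols of the expansion of `x`. -/
def freq {m : ℕ} (w : Fin m → Fin E.g) (x : ℝ) (n : ℕ) : ℝ :=
  (((Finset.range (n - m)).filter
      (fun i => ∀ k : Fin m, E.f^[i + k] x ∈ E.branch (w k))).card : ℝ) / ((n - m : ℕ) : ℝ)

/-- `G^{f,m}_{p̄}`: the set of points whose length-`m` word frequencies converge to `p̄`. -/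
def Gset (m : ℕ) (p : (Fin m → Fin E.g) → ℝ) : Set ℝ :=
  {x ∈ Ico (0:ℝ) 1 | ∀ w : Fin m → Fin E.g,
    Tendsto (fun n => E.freq w x n) atTop (nhds (p w))}

/-- `G^{f,m}_{p̄}(n,ε)`: points whose empirical length-`m` word frequencies at time `n`
are within `ε` of `p̄` componentwise. -/
def GsetApprox (m : ℕ) (p : (Fin m → Fin E.g) → ℝ) (n : ℕ) (ε : ℝ) : Set ℝ :=
  {x ∈ Ico (0:ℝ) 1 | ∀ w : Fin m → Fin E.g, |E.freq w x n - p w| < ε}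

/-- `p̄ ∈ A^{f,m}(x)`: the vector `p̄` is an accumulation point of the empirical
frequency vectors of `x` as `n → ∞`. -/
def IsFreqAccum (m : ℕ) (p : (Fin m → Fin E.g) → ℝ) (x : ℝ) : Prop :=
  MapClusterPt p atTop (fun n => fun w => E.freq w x n)

/-- `x` is `m`-normal to `f`: every length-`m` word occurs with frequency equal to
the length of the corresponding cylinder. -/
def IsNormal (m : ℕ) (x : ℝ) : Prop :=
  ∀ w : Fin m → Fin E.g,
    Tendsto (fun n => E.freq w x n) atTop (nhds (volume (E.cylinder (List.ofFn w))).toReal)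

/-- Bounded distortion with constant `K`:
`|C_u||C_v|/K ≤ |C_{uv}| ≤ K |C_u||C_v|` for all words `u, v`. -/
def HasBoundedDistortion (K : ℝ) : Prop :=
  ∀ u v : List (Fin E.g),
    volume (E.cylinder (u ++ v)) ≤
      ENNReal.ofReal K * (volume (E.cylinder u) * volume (E.cylinder v)) ∧
    volume (E.cylinder u) * volume (E.cylinder v) ≤
      ENNReal.ofReal K * volume (E.cylinder (u ++ v))

/-- Condition (ii): for each `m` there is `p̄` with `dim_H G^{f,m}_{p̄} = 1`, and for
each word `w` of length `m` there are vectors `q̄` with `q_w ≠ p_w` whose `G`-set has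
Hausdorff dimension arbitrarily close to `1`. -/
def CondII : Prop :=
  ∀ m : ℕ, 0 < m → ∃ p : (Fin m → Fin E.g) → ℝ, IsProbVector p ∧ dimH (E.Gset m p) = 1 ∧
    ∀ w : Fin m → Fin E.g, ∀ t : ℝ≥0∞, t < 1 → ∃ q : (Fin m → Fin E.g) → ℝ,
      IsProbVector q ∧ q w ≠ p w ∧ t ≤ dimH (E.Gset m q)

end ExpandingFullShift

/-! ### Dyadic intervals -/

/-- The dyadic interval `[k / 2 ^ n, (k + 1) / 2 ^ n)` with index `(n, k)`. -/
def dyIco (d : ℕ × ℤ) : Set ℝ := Ico ((d.2 : ℝ) / 2 ^ d.1) (((d.2 : ℝ) + 1) / 2 ^ d.1)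

/-- The interior of a dyadic interval. -/
def dyIoo (d : ℕ × ℤ) : Set ℝ := Ioo ((d.2 : ℝ) / 2 ^ d.1) (((d.2 : ℝ) + 1) / 2 ^ d.1)

/-- The closure of a dyadic interval. -/
def dyIcc (d : ℕ × ℤ) : Set ℝ := Icc ((d.2 : ℝ) / 2 ^ d.1) (((d.2 : ℝ) + 1) / 2 ^ d.1)

theorem dyIoo_subset_dyIco (d : ℕ × ℤ) : dyIoo d ⊆ dyIco d := Ioo_subset_Ico_self

theorem dyIco_subset_dyIcc (d : ℕ × ℤ) : dyIco d ⊆ dyIcc d := Ico_subset_Icc_self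

theorem mem_dyIco_iff {d : ℕ × ℤ} {x : ℝ} : x ∈ dyIco d ↔ ⌊x * 2 ^ d.1⌋ = d.2 := by
  have h : (0 : ℝ) < 2 ^ d.1 := by positivity
  rw [Int.floor_eq_iff, dyIco, mem_Ico, div_le_iff₀ h, lt_div_iff₀ h]

theorem left_mem_dyIco (d : ℕ × ℤ) : (d.2 : ℝ) / 2 ^ d.1 ∈ dyIco d := by
  have h : (0 : ℝ) < 2 ^ d.1 := by positivity
  rw [mem_dyIco_iff, div_mul_cancel₀ _ h.ne', Int.floor_intCast]

theorem dyIco_eq_of_mem {d e : ℕ × ℤ} {x : ℝ} (hd : x ∈ dyIco d) (he : x ∈ dyIco e)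
    (h : d.1 = e.1) : d = e := by
  rw [mem_dyIco_iff] at hd he
  ext
  · exact h
  · rw [← hd, ← he, h]

theorem dyIco_subset_of_mem {d e : ℕ × ℤ} {x : ℝ} (hd : x ∈ dyIco d) (he : x ∈ dyIco e)
    (h : e.1 ≤ d.1) : dyIco d ⊆ dyIco e := by
  have key : ∀ y : ℝ, ⌊y * 2 ^ e.1⌋ = ⌊y * 2 ^ d.1⌋ / (2 ^ (d.1 - e.1) : ℕ) := by
    intro y
    rw [← Int.floor_div_natCast]
    congr 1
    rw [eq_div_iff (by positivity), Nat.cast_pow, Nat.cast_ofNat, mul_assoc, ← pow_add]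
    congr 2
    omega
  intro y hy
  rw [mem_dyIco_iff] at *
  rw [key, hy, ← hd, ← key, he]

theorem level_le_of_dyIco_subset {d e : ℕ × ℤ} (h : dyIco d ⊆ dyIco e) : e.1 ≤ d.1 := by
  by_contra! hlt
  have h1 : dyIco e ⊆ dyIco d :=
    dyIco_subset_of_mem (h (left_mem_dyIco d)) (left_mem_dyIco d) hlt.le
  have h2 : volume (dyIco d) = volume (dyIco e) := by rw [h.antisymm h1]
  rw [dyIco, dyIco, Real.volume_Ico, Real.volume_Ico, ← sub_div, ← sub_div] at h2
  simp only [add_sub_cancel_left] at h2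
  rw [ENNReal.ofReal_eq_ofReal_iff (by positivity) (by positivity)] at h2
  have h3 : (2 : ℝ) ^ d.1 < 2 ^ e.1 := pow_lt_pow_right₀ (by norm_num) hlt
  have := one_div_lt_one_div_of_lt (by positivity) h3
  linarith

theorem dyIco_nested {d e : ℕ × ℤ} {x : ℝ} (hd : x ∈ dyIco d) (he : x ∈ dyIco e) :
    dyIco d ⊆ dyIco e ∨ dyIco e ⊆ dyIco d :=
  (le_total e.1 d.1).imp (dyIco_subset_of_mem hd he) (dyIco_subset_of_mem he hd)

theorem dyIoo_subset_of_dyIco_subset {d e : ℕ × ℤ} (h : dyIco d ⊆ dyIco e) :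
    dyIoo d ⊆ dyIoo e := by
  have := interior_mono h
  rwa [dyIco, dyIco, interior_Ico, interior_Ico] at this

theorem finite_setOf_dyIco_superset (d : ℕ × ℤ) : {e : ℕ × ℤ | dyIco d ⊆ dyIco e}.Finite := by
  refine ((Set.finite_Iic d.1).image
    (fun j => ((j, ⌊(d.2 : ℝ) / 2 ^ d.1 * 2 ^ j⌋) : ℕ × ℤ))).subset ?_
  intro e he
  refine ⟨e.1, level_le_of_dyIco_subset he, ?_⟩
  have := mem_dyIco_iff.1 (he (left_mem_dyIco d))
  simp [this]

/-- The left and right halves of a dyadic interval. -/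
def dyChild (d : ℕ × ℤ) (b : Bool) : ℕ × ℤ := (d.1 + 1, 2 * d.2 + if b then 1 else 0)

theorem dyChild_subset (d : ℕ × ℤ) (b : Bool) : dyIco (dyChild d b) ⊆ dyIco d := by
  have h : (0 : ℝ) < 2 ^ d.1 := by positivity
  cases b <;> simp only [dyChild, dyIco, pow_succ] <;> push_cast <;>
    refine Ico_subset_Ico ?_ ?_ <;> rw [div_le_div_iff₀ (by positivity) (by positivity)] <;>
    nlinarith

theorem dyIco_subset_dyChild {d e : ℕ × ℤ} (h : dyIco e ⊆ dyIco d) (hne : e ≠ d) :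
    ∃ b, dyIco e ⊆ dyIco (dyChild d b) := by
  have hx := h (left_mem_dyIco e)
  have hl : d.1 + 1 ≤ e.1 := by
    refine lt_of_le_of_ne (level_le_of_dyIco_subset h) fun h' => hne ?_
    exact dyIco_eq_of_mem (left_mem_dyIco e) hx h'.symm
  set x := (e.2 : ℝ) / 2 ^ e.1
  have h0 := mem_dyIco_iff.1 hx
  rw [Int.floor_eq_iff] at h0
  by_cases hc : x * 2 ^ d.1 < d.2 + 1 / 2
  · refine ⟨false, dyIco_subset_of_mem (left_mem_dyIco e) (mem_dyIco_iff.2 ?_) hl⟩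
    rw [Int.floor_eq_iff]
    simp only [dyChild, pow_succ]
    push_cast
    constructor <;> simp <;> nlinarith
  · refine ⟨true, dyIco_subset_of_mem (left_mem_dyIco e) (mem_dyIco_iff.2 ?_) hl⟩
    rw [Int.floor_eq_iff]
    simp only [dyChild, pow_succ]
    push_cast
    constructor <;> nlinarith

theorem dyChild_disjoint (d : ℕ × ℤ) (b : Bool) :
    Disjoint (dyIco (dyChild d b)) (dyIco (dyChild d !b)) := by
  rw [Set.disjoint_left]
  intro x hx hx'
  have := congrArg Prod.snd (dyIco_eq_of_mem hx hx' rfl)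
  cases b <;> simp [dyChild] at this

/-- The weight `|I| ^ t` of a dyadic interval. -/
def dyWeight (t : ℝ) (d : ℕ × ℤ) : ℝ := (2 : ℝ) ^ (-(t * d.1))

theorem dyWeight_pos (t : ℝ) (d : ℕ × ℤ) : 0 < dyWeight t d := by
  unfold dyWeight; positivity

theorem dyWeight_anti {t : ℝ} (ht : 0 ≤ t) {d e : ℕ × ℤ} (h : dyIco d ⊆ dyIco e) :
    dyWeight t d ≤ dyWeight t e := by
  unfold dyWeight
  have : (e.1 : ℝ) ≤ d.1 := by exact_mod_cast level_le_of_dyIco_subset h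
  exact Real.rpow_le_rpow_of_exponent_le (by norm_num) (by nlinarith)

theorem dyWeight_le_child {t : ℝ} (ht : t ≤ 1) (d : ℕ × ℤ) (b b' : Bool) :
    dyWeight t d ≤ dyWeight t (dyChild d b) + dyWeight t (dyChild d b') := by
  have h : dyWeight t d = 2 ^ t * dyWeight t (dyChild d true) := by
    unfold dyWeight dyChild
    rw [← Real.rpow_add (by norm_num)]
    push_cast
    ring_nf
  have h2 : (2 : ℝ) ^ t ≤ 2 := by
    simpa using Real.rpow_le_rpow_of_exponent_le (x := (2 : ℝ)) (by norm_num) ht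
  have h3 : ∀ b, dyWeight t (dyChild d b) = dyWeight t (dyChild d true) := fun b => rfl
  rw [h3 b, h3 b', h]
  nlinarith [dyWeight_pos t (dyChild d true)]

/-- The measure on indices giving a dyadic interval `I` the mass `|I| ^ t`. -/
def dyMeasure (t : ℝ) : Measure (ℕ × ℤ) :=
  Measure.count.withDensity fun d => ENNReal.ofReal (dyWeight t d)

theorem dyMeasure_apply (t : ℝ) (S : Set (ℕ × ℤ)) :
    dyMeasure t S = ∑' d : S, ENNReal.ofReal (dyWeight t d) := by
  rw [dyMeasure, withDensity_apply _ S.to_countable.measurableSet,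
    lintegral_countable' _ |>.trans, tsum_subtype S (fun d => ENNReal.ofReal (dyWeight t d))]
  congr 1
  ext d
  by_cases h : d ∈ S <;> simp [h, Measure.restrict_apply]

theorem dyMeasure_singleton (t : ℝ) (d : ℕ × ℤ) :
    dyMeasure t {d} = ENNReal.ofReal (dyWeight t d) := by
  rw [dyMeasure_apply]
  exact tsum_singleton d fun d => ENNReal.ofReal (dyWeight t d)

theorem le_dyMeasure (t : ℝ) {d : ℕ × ℤ} {S : Set (ℕ × ℤ)} (h : d ∈ S) :
    ENNReal.ofReal (dyWeight t d) ≤ dyMeasure t S := by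
  rw [← dyMeasure_singleton]
  exact measure_mono (by simpa using h)

theorem dyMeasure_image {ι : Type*} (t : ℝ) {f : ι → ℕ × ℤ} (hf : Function.Injective f)
    (A : Finset ι) : dyMeasure t (f '' A) = ∑ a ∈ A, ENNReal.ofReal (dyWeight t (f a)) := by
  rw [dyMeasure_apply, tsum_image (fun d => ENNReal.ofReal (dyWeight t d)) hf.injOn]
  exact Finset.tsum_subtype' A (fun a => ENNReal.ofReal (dyWeight t (f a)))

/-! ### Sets with large intersection -/

/-- `U` has full dyadic content of exponent `t` in every dyadic subinterval of `[0, 1)`. -/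
def HasFullContent (t : ℝ) (U : Set ℝ) : Prop :=
  ∀ d : ℕ × ℤ, dyIco d ⊆ Ico 0 1 → ∀ S : Set (ℕ × ℤ), U ∩ dyIoo d ⊆ ⋃ e ∈ S, dyIco e →
    ENNReal.ofReal (dyWeight t d) ≤ dyMeasure t S

theorem cover_restrict {U : Set ℝ} {d : ℕ × ℤ} {S : Set (ℕ × ℤ)}
    (hS : U ∩ dyIoo d ⊆ ⋃ e ∈ S, dyIco e) (hd : ∀ e ∈ S, dyIco d ⊆ dyIco e → e = d) :
    U ∩ dyIoo d ⊆ ⋃ e ∈ {e ∈ S | dyIco e ⊆ dyIco d}, dyIco e := by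
  intro x hx
  obtain ⟨e, he, hxe⟩ := mem_iUnion₂.1 (hS hx)
  refine mem_iUnion₂.2 ⟨e, ⟨he, ?_⟩, hxe⟩
  rcases dyIco_nested (dyIoo_subset_dyIco d hx.2) hxe with h | h
  · rw [hd e he h]
  · exact h

theorem content_improve_of_mem {t ρ : ℝ} (ht0 : 0 ≤ t) (ht : t ≤ 1) (h0 : 0 ≤ ρ) (h1 : ρ ≤ 1)
    {U : Set ℝ}
    (h : ∀ d : ℕ × ℤ, dyIco d ⊆ Ico 0 1 → ∀ S : Set (ℕ × ℤ), U ∩ dyIoo d ⊆ ⋃ e ∈ S, dyIco e →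
      ENNReal.ofReal (ρ * dyWeight t d) ≤ dyMeasure t S) (k : ℕ) :
    ∀ d : ℕ × ℤ, dyIco d ⊆ Ico 0 1 → ∀ S : Set (ℕ × ℤ), (∀ e ∈ S, dyIco e ⊆ dyIco d) →
      U ∩ dyIoo d ⊆ ⋃ e ∈ S, dyIco e → ∀ e ∈ S, e.1 ≤ d.1 + k →
      ENNReal.ofReal (ρ * dyWeight t d + (1 - ρ) * dyWeight t e) ≤ dyMeasure t S := by
  have base : ∀ (d : ℕ × ℤ) (S : Set (ℕ × ℤ)), d ∈ S → ∀ e, dyIco e ⊆ dyIco d →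
      ENNReal.ofReal (ρ * dyWeight t d + (1 - ρ) * dyWeight t e) ≤ dyMeasure t S := by
    intro d S hd e he
    refine le_trans (ENNReal.ofReal_le_ofReal ?_) (le_dyMeasure t hd)
    nlinarith [dyWeight_anti ht0 he]
  induction k with
  | zero =>
    intro d _ S hS _ e he hk
    have hed : e = d := dyIco_eq_of_mem (left_mem_dyIco e) (hS e he (left_mem_dyIco e))
      (le_antisymm hk (level_le_of_dyIco_subset (hS e he)))
    exact base d S (hed ▸ he) e (hS e he)
  | succ k ih =>
    intro d hd S hS hcov e he hk
    by_cases hdS : d ∈ S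
    · exact base d S hdS e (hS e he)
    obtain ⟨b, hb⟩ := dyIco_subset_dyChild (hS e he) (fun h' => hdS (h' ▸ he))
    have hmem : ∀ b', ∀ x ∈ U, x ∈ dyIoo (dyChild d b') →
        ∃ f ∈ {f ∈ S | dyIco f ⊆ dyIco (dyChild d b')}, x ∈ dyIco f := by
      intro b' x hU hx
      obtain ⟨f, hf, hxf⟩ := mem_iUnion₂.1
        (hcov ⟨hU, dyIoo_subset_of_dyIco_subset (dyChild_subset d b') hx⟩)
      refine ⟨f, ⟨hf, ?_⟩, hxf⟩
      obtain ⟨b'', hb''⟩ := dyIco_subset_dyChild (hS f hf) (fun h' => hdS (h' ▸ hf))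
      have := dyIco_eq_of_mem (hb'' hxf) (dyIoo_subset_dyIco _ hx) rfl
      rwa [this] at hb''
    have hcov' : ∀ b', U ∩ dyIoo (dyChild d b') ⊆
        ⋃ f ∈ {f ∈ S | dyIco f ⊆ dyIco (dyChild d b')}, dyIco f := by
      intro b' x hx
      obtain ⟨f, hf, hxf⟩ := hmem b' x hx.1 hx.2
      exact mem_iUnion₂.2 ⟨f, hf, hxf⟩
    have e1 := ih (dyChild d b) ((dyChild_subset d b).trans hd) _ (fun f hf => hf.2) (hcov' b) e
      ⟨he, hb⟩ (by simp only [dyChild]; omega)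
    have e2 := h (dyChild d !b) ((dyChild_subset d _).trans hd) _ (hcov' !b)
    have hdisj : Disjoint {f ∈ S | dyIco f ⊆ dyIco (dyChild d b)}
        {f ∈ S | dyIco f ⊆ dyIco (dyChild d !b)} := by
      rw [Set.disjoint_left]
      intro f hf hf'
      exact Set.disjoint_left.1 (dyChild_disjoint d b) (hf.2 (left_mem_dyIco f))
        (hf'.2 (left_mem_dyIco f))
    have e3 : dyMeasure t ({f ∈ S | dyIco f ⊆ dyIco (dyChild d b)} ∪
        {f ∈ S | dyIco f ⊆ dyIco (dyChild d !b)}) ≤ dyMeasure t S :=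
      measure_mono (union_subset (sep_subset _ _) (sep_subset _ _))
    rw [measure_union hdisj (Set.to_countable _).measurableSet] at e3
    refine le_trans ?_ ((add_le_add e1 e2).trans e3)
    have p1 := dyWeight_pos t e
    have p2 := dyWeight_pos t (dyChild d b)
    have p3 := dyWeight_pos t (dyChild d !b)
    rw [← ENNReal.ofReal_add (by have := mul_nonneg (sub_nonneg.2 h1) p1.le; positivity)
      (by positivity)]
    refine ENNReal.ofReal_le_ofReal ?_
    nlinarith [mul_le_mul_of_nonneg_left (dyWeight_le_child ht d b !b) h0]

theorem dyWeight_eq_mul {t : ℝ} {d e : ℕ × ℤ} {n : ℕ} (h : e.1 = d.1 + n) :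
    dyWeight t e = dyWeight t d * (2 : ℝ) ^ (-(t * n)) := by
  unfold dyWeight
  rw [← Real.rpow_add (by norm_num), h]
  push_cast
  ring_nf

theorem hasFullContent_of_le {s t c : ℝ} (ht0 : 0 ≤ t) (hts : t < s) (hs : s ≤ 1) (hc : 0 < c)
    {U : Set ℝ}
    (h : ∀ d : ℕ × ℤ, dyIco d ⊆ Ico 0 1 → ∀ S : Set (ℕ × ℤ), U ∩ dyIoo d ⊆ ⋃ e ∈ S, dyIco e →
      ENNReal.ofReal (c * dyWeight s d) ≤ dyMeasure s S) :
    HasFullContent t U := by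
  have ht : t ≤ 1 := by linarith
  obtain ⟨n, hn⟩ : ∃ n : ℕ, 1 ≤ c * 2 ^ ((s - t) * n) := by
    have h2 : (1 : ℝ) < 2 ^ (s - t) := Real.one_lt_rpow (by norm_num) (by linarith)
    obtain ⟨n, hn⟩ := pow_unbounded_of_one_lt c⁻¹ h2
    refine ⟨n, ?_⟩
    rw [Real.rpow_mul (by norm_num), Real.rpow_natCast]
    rw [inv_lt_iff_one_lt_mul₀ hc] at hn
    linarith
  have hscale : ∀ {d e : ℕ × ℤ}, d.1 ≤ e.1 →
      dyWeight s e * (2 : ℝ) ^ ((s - t) * d.1) ≤ dyWeight t e := by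
    intro d e hde
    unfold dyWeight
    rw [← Real.rpow_add (by norm_num)]
    have : (d.1 : ℝ) ≤ e.1 := by exact_mod_cast hde
    exact Real.rpow_le_rpow_of_exponent_le (by norm_num) (by nlinarith)
  have hscale' : ∀ S : Set (ℕ × ℤ), ∀ d : ℕ × ℤ, (∀ e ∈ S, d.1 ≤ e.1) →
      ENNReal.ofReal ((2 : ℝ) ^ ((s - t) * d.1)) * dyMeasure s S ≤ dyMeasure t S := by
    intro S d hS
    rw [dyMeasure_apply, dyMeasure_apply, ← ENNReal.tsum_mul_left]
    refine ENNReal.tsum_le_tsum fun e => ?_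
    rw [← ENNReal.ofReal_mul (by positivity), mul_comm]
    exact ENNReal.ofReal_le_ofReal (hscale (hS e e.2))
  set ε : ℝ := (2 : ℝ) ^ (-(t * n)) with hε
  have hε0 : 0 < ε := by positivity
  have hε1 : ε ≤ 1 := Real.rpow_le_one_of_one_le_of_nonpos (by norm_num)
    (by have : (0 : ℝ) ≤ n := n.cast_nonneg
        nlinarith)
  have hstep : ∀ ρ : ℝ, 0 ≤ ρ → ρ ≤ 1 →
      (∀ d : ℕ × ℤ, dyIco d ⊆ Ico 0 1 → ∀ S : Set (ℕ × ℤ), U ∩ dyIoo d ⊆ ⋃ e ∈ S, dyIco e →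
        ENNReal.ofReal (ρ * dyWeight t d) ≤ dyMeasure t S) →
      (∀ d : ℕ × ℤ, dyIco d ⊆ Ico 0 1 → ∀ S : Set (ℕ × ℤ), U ∩ dyIoo d ⊆ ⋃ e ∈ S, dyIco e →
        ENNReal.ofReal ((ρ + (1 - ρ) * ε) * dyWeight t d) ≤ dyMeasure t S) := by
    intro ρ h0 h1 hρ d hd S hS
    have hle : ρ + (1 - ρ) * ε ≤ 1 := by nlinarith
    have hwd := dyWeight_pos t d
    by_cases hbig : ∃ e ∈ S, dyIco d ⊆ dyIco e
    · obtain ⟨e, he, hde⟩ := hbig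
      refine le_trans (ENNReal.ofReal_le_ofReal ?_) (le_dyMeasure t he)
      have := dyWeight_anti ht0 hde
      nlinarith
    push Not at hbig
    have hcov := cover_restrict hS (fun e he h' => absurd h' (hbig e he))
    refine le_trans ?_ (measure_mono (sep_subset S (fun e => dyIco e ⊆ dyIco d)))
    by_cases hmid : ∃ e ∈ {e ∈ S | dyIco e ⊆ dyIco d}, e.1 ≤ d.1 + n
    · obtain ⟨e, he, hen⟩ := hmid
      refine le_trans (ENNReal.ofReal_le_ofReal ?_) (content_improve_of_mem ht0 ht h0 h1 hρ n d hd _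
        (fun e he => he.2) hcov e he hen)
      have hwe : dyWeight t d * ε ≤ dyWeight t e := by
        rw [hε, ← dyWeight_eq_mul (e := (d.1 + n, 0)) rfl]
        unfold dyWeight
        have : (e.1 : ℝ) ≤ d.1 + n := by exact_mod_cast hen
        refine Real.rpow_le_rpow_of_exponent_le (by norm_num) ?_
        push_cast
        nlinarith
      nlinarith
    · push Not at hmid
      refine le_trans ?_ (hscale' _ (d.1 + n, 0) (fun e he => (hmid e he).le))
      refine le_trans ?_ (mul_le_mul_right (h d hd _ hcov) _)
      rw [← ENNReal.ofReal_mul (by positivity)]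
      refine ENNReal.ofReal_le_ofReal ?_
      have hw : dyWeight t d = 2 ^ ((s - t) * d.1) * dyWeight s d := by
        unfold dyWeight
        rw [← Real.rpow_add (by norm_num)]
        ring_nf
      have hw2 : (2 : ℝ) ^ ((s - t) * ((d.1 + n : ℕ) : ℝ)) =
          2 ^ ((s - t) * d.1) * 2 ^ ((s - t) * n) := by
        rw [← Real.rpow_add (by norm_num)]
        push_cast
        ring_nf
      calc (ρ + (1 - ρ) * ε) * dyWeight t d ≤ 1 * dyWeight t d := by gcongr
        _ ≤ (c * 2 ^ ((s - t) * n)) * dyWeight t d := by gcongr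
        _ = _ := by rw [hw, hw2]; ring
  set c' : ℝ := min c 1
  have hc'0 : 0 < c' := lt_min hc one_pos
  have hc'1 : c' ≤ 1 := min_le_right _ _
  have hiter : ∀ k : ℕ, ∀ d : ℕ × ℤ, dyIco d ⊆ Ico 0 1 → ∀ S : Set (ℕ × ℤ),
      U ∩ dyIoo d ⊆ ⋃ e ∈ S, dyIco e →
        ENNReal.ofReal ((1 - (1 - c') * (1 - ε) ^ k) * dyWeight t d) ≤ dyMeasure t S := by
    intro k
    induction k with
    | zero =>
      intro d hd S hS
      by_cases hbig : ∃ e ∈ S, dyIco d ⊆ dyIco e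
      · obtain ⟨e, he, hde⟩ := hbig
        refine le_trans (ENNReal.ofReal_le_ofReal ?_) (le_dyMeasure t he)
        have := dyWeight_anti ht0 hde
        have hwd := dyWeight_pos t d
        rw [pow_zero]
        nlinarith
      push Not at hbig
      have hcov := cover_restrict hS (fun e he h' => absurd h' (hbig e he))
      refine le_trans ?_ (measure_mono (sep_subset S (fun e => dyIco e ⊆ dyIco d)))
      refine le_trans ?_ (hscale' _ d (fun e he => level_le_of_dyIco_subset he.2))
      refine le_trans ?_ (mul_le_mul_right (h d hd _ hcov) _)
      rw [← ENNReal.ofReal_mul (by positivity)]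
      refine ENNReal.ofReal_le_ofReal ?_
      have hw : dyWeight t d = 2 ^ ((s - t) * d.1) * dyWeight s d := by
        unfold dyWeight
        rw [← Real.rpow_add (by norm_num)]
        ring_nf
      have : c' * dyWeight t d ≤ c * dyWeight t d :=
        mul_le_mul_of_nonneg_right (min_le_left _ _) (dyWeight_pos t d).le
      calc _ = c' * dyWeight t d := by ring
        _ ≤ c * dyWeight t d := this
        _ = _ := by rw [hw]; ring
    | succ k ih =>
      have hp0 : 0 ≤ (1 - ε) ^ k := pow_nonneg (by linarith) k
      have hp1 : (1 - ε) ^ k ≤ 1 := pow_le_one₀ (by linarith) (by linarith)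
      have := hstep _ (by nlinarith) (by nlinarith) ih
      intro d hd S hS
      convert this d hd S hS using 3
      ring
  intro d hd S hS
  have hlim : Tendsto (fun k : ℕ => ENNReal.ofReal ((1 - (1 - c') * (1 - ε) ^ k) * dyWeight t d))
      atTop (nhds (ENNReal.ofReal ((1 - (1 - c') * 0) * dyWeight t d))) := by
    refine ENNReal.tendsto_ofReal (Tendsto.mul_const _ (Tendsto.const_sub _ (Tendsto.const_mul _ ?_)))
    exact tendsto_pow_atTop_nhds_zero_of_lt_one (by linarith) (by linarith)
  have := le_of_tendsto' hlim (fun k => hiter k d hd S hS)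
  simpa using this

/-- Every interval of `F` is contained in an interval of `S`. -/
def Dominates (S F : Set (ℕ × ℤ)) : Prop := ∀ d ∈ F, ∃ e ∈ S, dyIco d ⊆ dyIco e

/-- Distinct intervals of `F` are not nested. -/
def DyAntichain (F : Set (ℕ × ℤ)) : Prop := ∀ d ∈ F, ∀ e ∈ F, dyIco d ⊆ dyIco e → d = e

theorem HasFullContent.exists_dominates {t : ℝ} {U : Set ℝ} (hU : HasFullContent t U)
    {F S : Set (ℕ × ℤ)} (hF : DyAntichain F) (hF1 : ∀ d ∈ F, dyIco d ⊆ Ico 0 1)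
    (hS : U ∩ ⋃ d ∈ F, dyIoo d ⊆ ⋃ e ∈ S, dyIco e) :
    ∃ S', Dominates S' F ∧ dyMeasure t S' ≤ dyMeasure t S := by
  set B : Set (ℕ × ℤ) := {e ∈ S | ∃ d ∈ F, dyIco d ⊆ dyIco e}
  set R : Set (ℕ × ℤ) := {d ∈ F | ∀ e ∈ S, ¬ dyIco d ⊆ dyIco e}
  set T : ℕ × ℤ → Set (ℕ × ℤ) := fun d => {e ∈ S | dyIco e ⊆ dyIco d}
  have meas : ∀ A : Set (ℕ × ℤ), MeasurableSet A := fun A => A.to_countable.measurableSet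
  refine ⟨B ∪ R, fun d hd => ?_, ?_⟩
  · by_cases h : ∃ e ∈ S, dyIco d ⊆ dyIco e
    · obtain ⟨e, he, hde⟩ := h
      exact ⟨e, Or.inl ⟨he, d, hd, hde⟩, hde⟩
    · push Not at h
      exact ⟨d, Or.inr ⟨hd, h⟩, subset_rfl⟩
  have hw : ∀ d ∈ R, dyMeasure t {d} ≤ dyMeasure t (T d) := by
    intro d hd
    rw [dyMeasure_singleton]
    refine hU d (hF1 d hd.1) _ (cover_restrict ?_ (fun e he h' => absurd h' (hd.2 e he)))
    exact (inter_subset_inter_right U (subset_biUnion_of_mem (u := dyIoo) hd.1)).trans hS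
  have hTdisj : R.PairwiseDisjoint T := by
    intro d hd d' hd' hne
    refine Set.disjoint_left.2 fun e he he' => hne ?_
    rcases dyIco_nested (he.2 (left_mem_dyIco e)) (he'.2 (left_mem_dyIco e)) with h | h
    · exact hF d hd.1 d' hd'.1 h
    · exact (hF d' hd'.1 d hd.1 h).symm
  have hR : dyMeasure t R ≤ dyMeasure t (⋃ d ∈ R, T d) := by
    rw [measure_biUnion R.to_countable hTdisj (fun _ _ => meas _)]
    conv_lhs => rw [← biUnion_of_singleton R]
    rw [measure_biUnion R.to_countable (fun d _ d' _ h => by simpa using h) (fun _ _ => meas _)]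
    exact ENNReal.tsum_le_tsum fun d => hw d d.2
  have hdisj : Disjoint B (⋃ d ∈ R, T d) := by
    refine Set.disjoint_left.2 fun e he he' => ?_
    obtain ⟨d', hd', hd'e⟩ := he.2
    obtain ⟨d, hd, hed⟩ := mem_iUnion₂.1 he'
    have := hF d' hd' d hd.1 (hd'e.trans hed.2)
    exact hd.2 e he.1 (this ▸ hd'e)
  calc dyMeasure t (B ∪ R) ≤ dyMeasure t B + dyMeasure t R := measure_union_le _ _
    _ ≤ dyMeasure t B + dyMeasure t (⋃ d ∈ R, T d) := by gcongr
    _ = dyMeasure t (B ∪ ⋃ d ∈ R, T d) := (measure_union hdisj (meas _)).symm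
    _ ≤ dyMeasure t S := measure_mono
      (union_subset (sep_subset _ _) (iUnion₂_subset fun d _ => sep_subset _ _))

/-- Every family dominating `F` has total weight exceeding `c`. -/
def Heavy (t : ℝ) (c : ℝ≥0∞) (F : Set (ℕ × ℤ)) : Prop := ∀ S, Dominates S F → c < dyMeasure t S

theorem Heavy.exists_finite {t : ℝ} {c : ℝ≥0∞} {F : Set (ℕ × ℤ)} (h : Heavy t c F) :
    ∃ F' ⊆ F, F'.Finite ∧ Heavy t c F' := by
  by_contra! hcon
  have hS : ∀ A : Finset F, ∃ S, Dominates S (Subtype.val '' (A : Set F)) ∧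
      dyMeasure t S ≤ c := by
    intro A
    have := hcon (Subtype.val '' (A : Set F)) (by simp) (A.finite_toSet.image _)
    unfold Heavy at this
    push Not at this
    exact this
  choose S hdom hle using hS
  set u : Ultrafilter (Finset F) := Ultrafilter.of atTop
  have hu : ∀ A : Finset F, ∀ᶠ B in (u : Filter (Finset F)), A ≤ B := fun A =>
    Ultrafilter.of_le atTop (eventually_ge_atTop A)
  refine absurd (h {e | ∀ᶠ A in (u : Filter (Finset F)), e ∈ S A} ?_) (not_lt.2 ?_)
  · intro d hd
    have h1 : ∀ᶠ A in (u : Filter (Finset F)),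
        ∃ e ∈ {e : ℕ × ℤ | dyIco d ⊆ dyIco e}, e ∈ S A := by
      filter_upwards [hu {⟨d, hd⟩}] with A hA
      obtain ⟨e, he, hde⟩ := hdom A d ⟨⟨d, hd⟩, hA (by simp), rfl⟩
      exact ⟨e, hde, he⟩
    obtain ⟨e, he, hev⟩ :=
      (Ultrafilter.eventually_exists_mem_iff (finite_setOf_dyIco_superset d)).1 h1
    exact ⟨e, hev, he⟩
  · rw [dyMeasure_apply]
    refine ENNReal.summable.tsum_le_of_sum_le fun A => ?_
    have h1 : ∀ᶠ B in (u : Filter (Finset F)), ∀ e ∈ A, (e : ℕ × ℤ) ∈ S B :=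
      (Filter.eventually_all_finset A).2 fun e _ => e.2
    obtain ⟨B, hB⟩ := h1.exists
    refine le_trans ?_ (hle B)
    refine (dyMeasure_image t Subtype.val_injective A).symm.le.trans (measure_mono ?_)
    rintro _ ⟨e, he, rfl⟩
    exact hB e he

theorem exists_dyIco_mem_of_isOpen {W : Set ℝ} (hW : IsOpen W) {x : ℝ} (hx : x ∈ W) :
    ∃ d : ℕ × ℤ, x ∈ dyIco d ∧ dyIcc d ⊆ W := by
  obtain ⟨ε, hε, hball⟩ := Metric.isOpen_iff.1 hW x hx
  obtain ⟨n, hn⟩ := exists_pow_lt_of_lt_one hε (by norm_num : (1 / 2 : ℝ) < 1)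
  have hmem : x ∈ dyIco (n, ⌊x * 2 ^ n⌋) := mem_dyIco_iff.2 rfl
  refine ⟨(n, ⌊x * 2 ^ n⌋), hmem, fun y hy => hball ?_⟩
  have h2 : (0 : ℝ) < 2 ^ n := by positivity
  obtain ⟨h3, h4⟩ := hmem
  obtain ⟨h5, h6⟩ := hy
  rw [one_div, inv_pow] at hn
  rw [add_div, one_div] at h4 h6
  rw [Metric.mem_ball, Real.dist_eq, abs_lt]
  constructor <;> linarith

theorem HasFullContent.exists_refinement {t : ℝ} {c : ℝ≥0∞} {U : Set ℝ}
    (hU : HasFullContent t U) (hopen : IsOpen U) {F : Set (ℕ × ℤ)} (hF : DyAntichain F)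
    (hF1 : ∀ d ∈ F, dyIco d ⊆ Ico 0 1) (hc : Heavy t c F) :
    ∃ F' : Set (ℕ × ℤ), F'.Finite ∧ DyAntichain F' ∧ Heavy t c F' ∧
      ∀ d ∈ F', dyIcc d ⊆ U ∩ ⋃ e ∈ F, dyIoo e := by
  set W : Set ℝ := U ∩ ⋃ e ∈ F, dyIoo e
  have hW : IsOpen W := hopen.inter (isOpen_biUnion fun d _ => isOpen_Ioo)
  set M : Set (ℕ × ℤ) := {d | dyIcc d ⊆ W ∧ ∀ e, dyIcc e ⊆ W → dyIco d ⊆ dyIco e → e = d}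
  have hM : Heavy t c M := by
    intro S hS
    obtain ⟨S', hdom, hle⟩ := hU.exists_dominates hF hF1 (S := S) (by
      intro x hx
      obtain ⟨d, hxd, hdW⟩ := exists_dyIco_mem_of_isOpen hW hx
      set N : Set (ℕ × ℤ) := {e | dyIcc e ⊆ W ∧ dyIco d ⊆ dyIco e}
      have hN : d ∈ N := ⟨hdW, subset_rfl⟩
      have hmin := Function.argminOn_mem Prod.fst N ⟨d, hN⟩
      set m := Function.argminOn Prod.fst N ⟨d, hN⟩
      have hmM : m ∈ M := by
        refine ⟨hmin.1, fun e he hme => ?_⟩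
        have h1 : m.1 ≤ e.1 := Function.argminOn_le Prod.fst N ⟨he, hmin.2.trans hme⟩
        exact dyIco_eq_of_mem (hme (left_mem_dyIco m)) (left_mem_dyIco m)
          (le_antisymm (level_le_of_dyIco_subset hme) h1)
      obtain ⟨e, he, hme⟩ := hS m hmM
      exact mem_iUnion₂.2 ⟨e, he, hme (hmin.2 hxd)⟩)
    exact (hc S' hdom).trans_le hle
  obtain ⟨F', hsub, hfin, hheavy⟩ := hM.exists_finite
  refine ⟨F', hfin, fun d hd e he hde => ?_, hheavy, fun d hd => (hsub hd).1⟩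
  exact ((hsub hd).2 e (hsub he).1 hde).symm

theorem exists_level {t δ η : ℝ} (ht0 : 0 < t) (ht : t ≤ 1) (hδ0 : 0 ≤ δ) (hδ : δ ≤ 1)
    (hη : 0 < η) : ∃ n : ℕ, δ ≤ 2⁻¹ ^ n ∧ (2 : ℝ) ^ (-(t * n)) ≤ 2 * δ ^ t + η := by
  rcases hδ0.eq_or_lt with rfl | hpos
  · obtain ⟨n, hn⟩ := exists_pow_lt_of_lt_one hη
      (Real.rpow_lt_one_of_one_lt_of_neg (x := 2) (z := -t) (by norm_num) (by linarith))
    refine ⟨n, by positivity, ?_⟩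
    rw [← Real.rpow_natCast, ← Real.rpow_mul (by norm_num), neg_mul] at hn
    have : (0 : ℝ) ≤ 2 * 0 ^ t := by positivity
    linarith
  · obtain ⟨n, hn1, hn2⟩ := exists_nat_pow_near_of_lt_one hpos hδ
      (by norm_num : (0 : ℝ) < 2⁻¹) (by norm_num)
    refine ⟨n, hn2, ?_⟩
    have h1 : (2 : ℝ)⁻¹ ^ n ≤ 2 * δ := by
      rw [pow_succ] at hn1
      linarith
    have h2 := Real.rpow_le_rpow (by positivity) h1 ht0.le
    rw [Real.mul_rpow (by norm_num) hδ0] at h2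
    have h3 : (2 : ℝ) ^ t ≤ 2 := by
      simpa using Real.rpow_le_rpow_of_exponent_le (x := (2 : ℝ)) (by norm_num) ht
    have h4 : ((2 : ℝ)⁻¹ ^ n) ^ t = 2 ^ (-(t * n)) := by
      rw [inv_pow, Real.inv_rpow (by positivity), Real.rpow_neg (by norm_num),
        ← Real.rpow_natCast, ← Real.rpow_mul (by norm_num), mul_comm]
    rw [← h4]
    have h5 : 0 ≤ δ ^ t := by positivity
    nlinarith

theorem Ioo_subset_biUnion_dyIco (x : ℝ) (n : ℕ) :
    Ioo (x - 2 * 2⁻¹ ^ n) (x + 2 * 2⁻¹ ^ n) ⊆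
      ⋃ e ∈ (fun j : ℤ => ((n, ⌊x * 2 ^ n⌋ + j) : ℕ × ℤ)) '' (Finset.Icc (-2) 2 : Finset ℤ),
        dyIco e := by
  intro y hy
  have h2 : (0 : ℝ) < 2 ^ n := by positivity
  rw [inv_pow] at hy
  have h3 : (2 : ℝ) ^ n * (2 ^ n)⁻¹ = 1 := mul_inv_cancel₀ h2.ne'
  have h4 : x * 2 ^ n - 2 < y * 2 ^ n := by nlinarith [hy.1]
  have h5 : y * 2 ^ n < x * 2 ^ n + 2 := by nlinarith [hy.2]
  refine mem_iUnion₂.2 ⟨(n, ⌊y * 2 ^ n⌋), ⟨⌊y * 2 ^ n⌋ - ⌊x * 2 ^ n⌋, ?_, by simp⟩,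
    mem_dyIco_iff.2 rfl⟩
  have a1 := Int.floor_le (x * 2 ^ n)
  have a2 := Int.lt_floor_add_one (x * 2 ^ n)
  have a3 := Int.floor_le (y * 2 ^ n)
  have a4 := Int.lt_floor_add_one (y * 2 ^ n)
  have b1 : (⌊x * 2 ^ n⌋ : ℝ) < ⌊y * 2 ^ n⌋ + 3 := by linarith
  have b2 : (⌊y * 2 ^ n⌋ : ℝ) < ⌊x * 2 ^ n⌋ + 3 := by linarith
  have b1' : ⌊x * 2 ^ n⌋ < ⌊y * 2 ^ n⌋ + 3 := by exact_mod_cast b1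
  have b2' : ⌊y * 2 ^ n⌋ < ⌊x * 2 ^ n⌋ + 3 := by exact_mod_cast b2
  simp only [Finset.coe_Icc, mem_Icc]
  omega

/-- A bounded set null for the `t`-dimensional Hausdorff measure lies in an open set covered by
dyadic intervals of small total weight. -/
theorem exists_cover_of_hausdorffMeasure_eq_zero {t : ℝ} (ht0 : 0 < t) (ht : t ≤ 1) {K : Set ℝ}
    (hK : Measure.hausdorffMeasure t K = 0) {ε : ℝ≥0∞} (hε : 0 < ε) :
    ∃ (O : Set ℝ) (S : Set (ℕ × ℤ)), IsOpen O ∧ K ⊆ O ∧ O ⊆ ⋃ e ∈ S, dyIco e ∧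
      dyMeasure t S ≤ ε := by
  obtain ⟨ε', hε'0, hε'⟩ : ∃ ε' : ℝ≥0∞, 0 < ε' ∧ 15 * ε' ≤ ε := by
    refine ⟨ε / 15, ENNReal.div_pos hε.ne' (by norm_num), ?_⟩
    exact (ENNReal.mul_div_le)
  obtain ⟨η, hη0, hη⟩ := ENNReal.exists_pos_sum_of_countable hε'0.ne' ℕ
  rw [Measure.hausdorffMeasure_apply] at hK
  have h1 := le_of_eq (ENNReal.iSup_eq_zero.1 (ENNReal.iSup_eq_zero.1 hK 1) one_pos)
  have h2 := h1.trans_lt hε'0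
  simp only [iInf_lt_iff] at h2
  obtain ⟨T, hKT, hdiam, hsum⟩ := h2
  have hball : ∀ i, ∃ (O : Set ℝ) (S : Set (ℕ × ℤ)), IsOpen O ∧ T i ⊆ O ∧
      O ⊆ ⋃ e ∈ S, dyIco e ∧
      dyMeasure t S ≤ 5 * (2 * (⨆ _ : (T i).Nonempty, Metric.ediam (T i) ^ t) + η i) := by
    intro i
    rcases (T i).eq_empty_or_nonempty with he | ⟨x, hx⟩
    · exact ⟨∅, ∅, isOpen_empty, he.subset, empty_subset _, by simp⟩
    set δ := (Metric.ediam (T i)).toReal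
    have hfin : Metric.ediam (T i) ≠ ⊤ := ((hdiam i).trans_lt ENNReal.one_lt_top).ne
    have hδ : Metric.ediam (T i) = ENNReal.ofReal δ := (ENNReal.ofReal_toReal hfin).symm
    have hδ1 : δ ≤ 1 := ENNReal.toReal_le_of_le_ofReal zero_le_one (by simpa using hdiam i)
    obtain ⟨n, hn1, hn2⟩ := exists_level ht0 ht ENNReal.toReal_nonneg hδ1
      (NNReal.coe_pos.2 (hη0 i))
    refine ⟨_, _, isOpen_Ioo, ?_, Ioo_subset_biUnion_dyIco x n, ?_⟩
    · intro y hy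
      have h5 : edist x y ≤ ENNReal.ofReal δ := hδ ▸ Metric.edist_le_ediam_of_mem hx hy
      rw [edist_dist, ENNReal.ofReal_le_ofReal_iff ENNReal.toReal_nonneg, Real.dist_eq,
        abs_le] at h5
      have h6 : (0 : ℝ) < 2⁻¹ ^ n := by positivity
      constructor <;> linarith
    · have hne : (T i).Nonempty := ⟨x, hx⟩
      simp only [hne, iSup_pos]
      rw [dyMeasure_image t (fun a b h => by simpa using h)]
      simp only [dyWeight, Finset.sum_const, Int.card_Icc, nsmul_eq_mul]
      refine mul_le_mul' (show ((5 : ℕ) : ℝ≥0∞) ≤ 5 by simp) ?_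
      refine (ENNReal.ofReal_le_ofReal hn2).trans ?_
      rw [ENNReal.ofReal_add (by positivity) (by positivity), ENNReal.ofReal_mul (by norm_num),
        ← ENNReal.ofReal_rpow_of_nonneg ENNReal.toReal_nonneg ht0.le, ← hδ]
      simp
  choose O S hO hTO hOS hS using hball
  refine ⟨⋃ i, O i, ⋃ i, S i, isOpen_iUnion hO, hKT.trans (iUnion_mono hTO), ?_, ?_⟩
  · refine iUnion_subset fun i => (hOS i).trans ?_
    exact biUnion_subset_biUnion_left (subset_iUnion S i)
  · refine (measure_iUnion_le S).trans ((ENNReal.tsum_le_tsum hS).trans (le_trans ?_ hε'))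
    rw [ENNReal.tsum_mul_left, ENNReal.tsum_add, ENNReal.tsum_mul_left]
    calc _ ≤ 5 * (2 * ε' + ε') := by gcongr
      _ = 15 * ε' := by ring

theorem dimH_iInter_of_hasFullContent {t : ℝ} (ht0 : 0 < t) (ht : t ≤ 1) {U : ℕ → Set ℝ}
    (hopen : ∀ k, IsOpen (U k)) (hU : ∀ k, HasFullContent t (U k)) :
    ENNReal.ofReal t ≤ dimH (Ioo (0 : ℝ) 1 ∩ ⋂ k, U k) := by
  have hroot : dyIco (0, 0) = Ico 0 1 := by simp [dyIco]
  have hroot' : dyIoo (0, 0) = Ioo 0 1 := by simp [dyIoo]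
  set Good : Set (ℕ × ℤ) → Prop := fun F => F.Finite ∧ DyAntichain F ∧
    (∀ d ∈ F, dyIco d ⊆ Ico 0 1) ∧ Heavy t (1 / 2) F
  have hgood0 : Good {(0, 0)} := by
    refine ⟨Set.finite_singleton _, by simp [DyAntichain], by simp [hroot], fun S hS => ?_⟩
    obtain ⟨e, he, hde⟩ := hS _ rfl
    refine lt_of_lt_of_le ?_ (le_dyMeasure t he)
    have h1 : (1 : ℝ) ≤ dyWeight t e := by
      simpa [dyWeight] using dyWeight_anti ht0.le hde
    refine lt_of_lt_of_le ?_ (ENNReal.ofReal_le_ofReal h1)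
    simp
  have hstep : ∀ (k : ℕ) (F : {F // Good F}), ∃ F' : {F // Good F},
      ∀ d ∈ F'.1, dyIcc d ⊆ U k ∩ ⋃ e ∈ F.1, dyIoo e := by
    rintro k ⟨F, hfin, hanti, hsub, hheavy⟩
    obtain ⟨F', h1, h2, h3, h4⟩ := (hU k).exists_refinement (hopen k) hanti hsub hheavy
    refine ⟨⟨F', h1, h2, fun d hd x hx => ?_, h3⟩, h4⟩
    obtain ⟨e, he, hxe⟩ := mem_iUnion₂.1 (h4 d hd (dyIco_subset_dyIcc d hx)).2
    exact hsub e he (dyIoo_subset_dyIco e hxe)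
  choose next hnext using hstep
  set F : ℕ → {F // Good F} := fun n => Nat.rec ⟨{(0, 0)}, hgood0⟩ next n
  have hF : ∀ n, ∀ d ∈ (F (n + 1)).1, dyIcc d ⊆ U n ∩ ⋃ e ∈ (F n).1, dyIoo e :=
    fun n => hnext n (F n)
  set D : ℕ → Set ℝ := fun n => ⋃ d ∈ (F n).1, dyIcc d
  have hDU : ∀ n, D (n + 1) ⊆ U n := fun n => iUnion₂_subset fun d hd x hx => (hF n d hd hx).1
  have hDD : ∀ n, D (n + 1) ⊆ ⋃ e ∈ (F n).1, dyIoo e :=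
    fun n => iUnion₂_subset fun d hd x hx => (hF n d hd hx).2
  have hDanti : Antitone D := antitone_nat_of_succ_le fun n =>
    (hDD n).trans (biUnion_mono subset_rfl fun d _ => Ioo_subset_Icc_self)
  have hDcomp : ∀ n, IsCompact (D n) := fun n =>
    (F n).2.1.isCompact_biUnion fun d _ => isCompact_Icc
  set K : Set ℝ := ⋂ n, D n
  have hKsub : K ⊆ Ioo (0 : ℝ) 1 ∩ ⋂ k, U k := by
    intro x hx
    have hx' := mem_iInter.1 hx
    refine ⟨?_, mem_iInter.2 fun k => hDU k (hx' (k + 1))⟩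
    obtain ⟨e, he, hxe⟩ := mem_iUnion₂.1 (hDD 0 (hx' 1))
    have he' : e = (0, 0) := he
    rwa [he', hroot'] at hxe
  by_contra! hlt
  have hK0 : Measure.hausdorffMeasure t K = 0 := by
    have := hausdorffMeasure_of_dimH_lt (s := K) (d := t.toNNReal)
      ((dimH_mono hKsub).trans_lt hlt)
    rwa [Real.coe_toNNReal t ht0.le] at this
  obtain ⟨O, S, hO, hKO, hOS, hS⟩ :=
    exists_cover_of_hausdorffMeasure_eq_zero ht0 ht hK0 (ε := 1 / 2) (by simp)
  obtain ⟨n, hn⟩ := exists_subset_nhds_of_isCompact' (V := D) hDanti.directed_ge hDcomp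
    (fun n => (hDcomp n).isClosed) (fun x hx => hO.mem_nhds (hKO hx))
  obtain ⟨S', hdom, hle⟩ := (hU 0).exists_dominates (F n).2.2.1 (F n).2.2.2.1 (S := S) (by
    refine inter_subset_right.trans (Subset.trans ?_ (hn.trans hOS))
    exact biUnion_mono subset_rfl fun d _ => Ioo_subset_Icc_self)
  exact absurd ((F n).2.2.2.2 S' hdom) (not_lt.2 (hle.trans hS))

/-! ### Cylinders of a full shift -/

namespace ExpandingFullShift

variable (E : ExpandingFullShift)

/-- The length of a cylinder. -/
def cylLen (v : List (Fin E.g)) : ℝ := (volume (E.cylinder v)).toReal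

/-- The points of `[0, 1)` whose orbit hits `0`. -/
def zeroOrbit : Set ℝ := {x ∈ Ico (0 : ℝ) 1 | ∃ k, E.f^[k] x = 0}

variable {E}

theorem branch_subset (i : Fin E.g) : E.branch i ⊆ Ico 0 1 :=
  E.branch_cover ▸ subset_iUnion E.branch i

theorem exists_mem_branch {x : ℝ} (hx : x ∈ Ico (0 : ℝ) 1) : ∃ i, x ∈ E.branch i := by
  rwa [← E.branch_cover, mem_iUnion] at hx

theorem eq_of_mem_branch {x : ℝ} {i j : Fin E.g} (hi : x ∈ E.branch i) (hj : x ∈ E.branch j) :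
    i = j := by
  by_contra h
  exact Set.disjoint_left.1 (E.branch_disjoint i j h) hi hj

theorem f_mem {x : ℝ} (hx : x ∈ Ico (0 : ℝ) 1) : E.f x ∈ Ico (0 : ℝ) 1 := by
  obtain ⟨i, hi⟩ := exists_mem_branch hx
  exact E.f_onto i ▸ mem_image_of_mem E.f hi

theorem iterate_mem {x : ℝ} (hx : x ∈ Ico (0 : ℝ) 1) (k : ℕ) : E.f^[k] x ∈ Ico (0 : ℝ) 1 := by
  induction k with
  | zero => exact hx
  | succ k ih => rw [Function.iterate_succ_apply']; exact f_mem ih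

theorem f_strictMonoOn (i : Fin E.g) : StrictMonoOn E.f (E.branch i) := by
  refine (E.f_mono i).resolve_right fun hanti => ?_
  obtain ⟨a, b, hab, hi⟩ := E.branch_Ico i
  have ha : a ∈ E.branch i := hi ▸ left_mem_Ico.2 hab
  have h1 := f_mem (E := E) (branch_subset i ha)
  obtain ⟨y, hy, hfy⟩ : (E.f a + 1) / 2 ∈ E.f '' E.branch i := by
    rw [E.f_onto i]
    constructor <;> linarith [h1.1, h1.2]
  have h2 := hanti.antitoneOn ha hy (by rw [hi] at hy; exact hy.1)
  linarith [h1.2]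

theorem ordConnected_branch (i : Fin E.g) : (E.branch i).OrdConnected := by
  obtain ⟨a, b, -, hi⟩ := E.branch_Ico i
  rw [hi]
  exact ordConnected_Ico

theorem f_zero : E.f 0 = 0 := by
  have h0 : (0 : ℝ) ∈ Ico (0 : ℝ) 1 := by simp
  obtain ⟨i, hi⟩ := exists_mem_branch (E := E) h0
  obtain ⟨y, hy, hfy⟩ : (0 : ℝ) ∈ E.f '' E.branch i := by
    rw [E.f_onto i]; exact h0
  have h1 := (f_strictMonoOn i).monotoneOn hi hy (branch_subset i hy).1
  exact le_antisymm (hfy ▸ h1) (f_mem h0).1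

theorem cylinder_subset (v : List (Fin E.g)) : E.cylinder v ⊆ Ico 0 1 := sep_subset _ _

theorem cylinder_nil : E.cylinder [] = Ico 0 1 := by
  simp [cylinder, Ico]

theorem mem_cylinder_cons {i : Fin E.g} {v : List (Fin E.g)} {x : ℝ} :
    x ∈ E.cylinder (i :: v) ↔ x ∈ E.branch i ∧ E.f x ∈ E.cylinder v := by
  constructor
  · rintro ⟨hx, h⟩
    exact ⟨h 0 (by simp), f_mem hx, fun k hk => h (k + 1) (by simpa using hk)⟩
  · rintro ⟨hx, -, h⟩
    refine ⟨branch_subset i hx, fun k hk => ?_⟩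
    cases k with
    | zero => exact hx
    | succ k => exact h k (by simpa using hk)

theorem mem_cylinder_append {u v : List (Fin E.g)} {x : ℝ} :
    x ∈ E.cylinder (u ++ v) ↔ x ∈ E.cylinder u ∧ E.f^[u.length] x ∈ E.cylinder v := by
  induction u generalizing x with
  | nil =>
    rw [cylinder_nil]
    exact ⟨fun h => ⟨cylinder_subset v h, h⟩, fun h => h.2⟩
  | cons i u ih =>
    rw [List.cons_append, mem_cylinder_cons, ih, mem_cylinder_cons, and_assoc]
    rfl

theorem strictMonoOn_iterate (v : List (Fin E.g)) :
    StrictMonoOn E.f^[v.length] (E.cylinder v) := by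
  induction v with
  | nil => exact fun x _ y _ h => h
  | cons i v ih =>
    intro x hx y hy hxy
    rw [mem_cylinder_cons] at hx hy
    exact ih hx.2 hy.2 (f_strictMonoOn i hx.1 hy.1 hxy)

theorem surjOn_iterate (v : List (Fin E.g)) :
    SurjOn E.f^[v.length] (E.cylinder v) (Ico 0 1) := by
  induction v with
  | nil => exact fun x hx => ⟨x, by rwa [cylinder_nil], rfl⟩
  | cons i v ih =>
    intro y hy
    obtain ⟨z, hz, rfl⟩ := ih hy
    obtain ⟨x, hx, rfl⟩ : z ∈ E.f '' E.branch i := by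
      rw [E.f_onto i]; exact cylinder_subset v hz
    exact ⟨x, mem_cylinder_cons.2 ⟨hx, hz⟩, rfl⟩

theorem ordConnected_cylinder (v : List (Fin E.g)) : (E.cylinder v).OrdConnected := by
  induction v with
  | nil => rw [cylinder_nil]; exact ordConnected_Ico
  | cons i v ih =>
    refine ⟨fun x hx y hy z hz => ?_⟩
    rw [mem_cylinder_cons] at *
    have hzi : z ∈ E.branch i := (ordConnected_branch i).out hx.1 hy.1 hz
    have hm := (f_strictMonoOn i).monotoneOn
    exact ⟨hzi, ih.out hx.2 hy.2 ⟨hm hx.1 hzi hz.1, hm hzi hy.1 hz.2⟩⟩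

theorem measurableSet_cylinder (v : List (Fin E.g)) : MeasurableSet (E.cylinder v) :=
  (ordConnected_cylinder v).measurableSet

theorem volume_cylinder_ne_top (v : List (Fin E.g)) : volume (E.cylinder v) ≠ ⊤ :=
  ((measure_mono (cylinder_subset v)).trans_lt (by simp)).ne

theorem ofReal_cylLen (v : List (Fin E.g)) :
    ENNReal.ofReal (E.cylLen v) = volume (E.cylinder v) :=
  ENNReal.ofReal_toReal (volume_cylinder_ne_top v)

theorem cylLen_nil : E.cylLen [] = 1 := by simp [cylLen, cylinder_nil]

theorem sub_le_cylLen {v : List (Fin E.g)} {x y : ℝ} (hx : x ∈ E.cylinder v)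
    (hy : y ∈ E.cylinder v) : y - x ≤ E.cylLen v := by
  have h := measure_mono (μ := volume) ((ordConnected_cylinder v).out hx hy)
  rw [Real.volume_Icc, ← ofReal_cylLen] at h
  exact (ENNReal.ofReal_le_ofReal_iff ENNReal.toReal_nonneg).1 h

theorem cylLen_pos (v : List (Fin E.g)) : 0 < E.cylLen v := by
  obtain ⟨x, hx, hfx⟩ := surjOn_iterate v (show (0 : ℝ) ∈ Ico (0 : ℝ) 1 by simp)
  obtain ⟨y, hy, hfy⟩ := surjOn_iterate v (show (1 / 2 : ℝ) ∈ Ico (0 : ℝ) 1 by norm_num)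
  have hxy : x < y := ((strictMonoOn_iterate v).lt_iff_lt hx hy).1 (by rw [hfx, hfy]; norm_num)
  linarith [sub_le_cylLen hx hy]

theorem cylinder_append_subset (u v : List (Fin E.g)) : E.cylinder (u ++ v) ⊆ E.cylinder u :=
  fun _ hx => (mem_cylinder_append.1 hx).1

theorem exists_mem_cylinder {x : ℝ} (hx : x ∈ Ico (0 : ℝ) 1) (n : ℕ) :
    ∃ v : List (Fin E.g), v.length = n ∧ x ∈ E.cylinder v := by
  induction n generalizing x with
  | zero => exact ⟨[], rfl, by rwa [cylinder_nil]⟩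
  | succ n ih =>
    obtain ⟨i, hi⟩ := exists_mem_branch hx
    obtain ⟨v, hv, hxv⟩ := ih (f_mem (E := E) hx)
    exact ⟨i :: v, by simp [hv], mem_cylinder_cons.2 ⟨hi, hxv⟩⟩

theorem eq_of_mem_cylinder {u v : List (Fin E.g)} (h : u.length = v.length) {x : ℝ}
    (hu : x ∈ E.cylinder u) (hv : x ∈ E.cylinder v) : u = v :=
  List.ext_get h fun k hk hk' => eq_of_mem_branch (hu.2 k hk) (hv.2 k hk')

theorem iterate_zero_eq (k : ℕ) : E.f^[k] 0 = 0 := by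
  induction k with
  | zero => rfl
  | succ k ih => rw [Function.iterate_succ_apply, f_zero, ih]

theorem zeroOrbit_of_iterate {x : ℝ} (hx : x ∈ E.zeroOrbit) (l : ℕ) :
    E.f^[l] x ∈ E.zeroOrbit := by
  obtain ⟨hx, k, hk⟩ := hx
  exact ⟨iterate_mem hx l, k, by
    rw [← Function.iterate_add_apply, add_comm, Function.iterate_add_apply, hk, iterate_zero_eq]⟩

theorem countable_zeroOrbit : E.zeroOrbit.Countable := by
  have h : ∀ k : ℕ, {x ∈ Ico (0 : ℝ) 1 | E.f^[k] x = 0}.Countable := by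
    intro k
    induction k with
    | zero => exact (Set.countable_singleton (0 : ℝ)).mono fun x hx => hx.2
    | succ k ih =>
      have : {x ∈ Ico (0 : ℝ) 1 | E.f^[k + 1] x = 0} ⊆
          ⋃ i, {x ∈ E.branch i | E.f x ∈ {x ∈ Ico (0 : ℝ) 1 | E.f^[k] x = 0}} := by
        rintro x ⟨hx, hfx⟩
        obtain ⟨i, hi⟩ := exists_mem_branch hx
        exact mem_iUnion.2 ⟨i, hi, f_mem hx, hfx⟩
      refine (countable_iUnion fun i => ?_).mono this
      refine MapsTo.countable_of_injOn (f := E.f) (fun x hx => hx.2) ?_ ih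
      exact (f_strictMonoOn i).injOn.mono (sep_subset _ _)
  refine (countable_iUnion h).mono ?_
  rintro x ⟨hx, k, hk⟩
  exact mem_iUnion.2 ⟨k, hx, hk⟩

theorem cylinder_mem_nhds {v : List (Fin E.g)} {x : ℝ} (hx : x ∈ E.cylinder v)
    (h0 : x ∉ E.zeroOrbit) : E.cylinder v ∈ nhds x := by
  have hxI := cylinder_subset v hx
  have hT := iterate_mem (E := E) hxI v.length
  have hpos : 0 < E.f^[v.length] x :=
    hT.1.lt_of_ne fun h => h0 ⟨hxI, v.length, h.symm⟩
  obtain ⟨y, hy, hfy⟩ := surjOn_iterate v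
    (show E.f^[v.length] x / 2 ∈ Ico (0 : ℝ) 1 by constructor <;> linarith [hT.1, hT.2])
  obtain ⟨z, hz, hfz⟩ := surjOn_iterate v
    (show (E.f^[v.length] x + 1) / 2 ∈ Ico (0 : ℝ) 1 by constructor <;> linarith [hT.1, hT.2])
  have hyx : y < x := ((strictMonoOn_iterate v).lt_iff_lt hy hx).1 (by rw [hfy]; linarith)
  have hxz : x < z := ((strictMonoOn_iterate v).lt_iff_lt hx hz).1 (by rw [hfz]; linarith [hT.2])
  exact mem_of_superset (Icc_mem_nhds hyx hxz) ((ordConnected_cylinder v).out hy hz)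

/-! ### Consequences of bounded distortion -/

theorem HasBoundedDistortion.mul_le {K : ℝ} (hK : 1 ≤ K) (h : E.HasBoundedDistortion K)
    (u v : List (Fin E.g)) : E.cylLen u * E.cylLen v ≤ K * E.cylLen (u ++ v) := by
  have h1 := (h u v).2
  rw [← ofReal_cylLen, ← ofReal_cylLen, ← ofReal_cylLen,
    ← ENNReal.ofReal_mul (cylLen_pos u).le, ← ENNReal.ofReal_mul (by linarith)] at h1
  exact (ENNReal.ofReal_le_ofReal_iff (mul_nonneg (by linarith) ENNReal.toReal_nonneg)).1 h1

theorem HasBoundedDistortion.exists_child_ratio {K : ℝ} (hK : 1 ≤ K)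
    (h : E.HasBoundedDistortion K) :
    ∃ β : ℝ, 0 < β ∧ β < 1 ∧ ∀ (v : List (Fin E.g)) (i : Fin E.g),
      β * E.cylLen v ≤ E.cylLen (v ++ [i]) ∧ E.cylLen (v ++ [i]) ≤ (1 - β) * E.cylLen v := by
  have : Nonempty (Fin E.g) := ⟨E.zeroSym⟩
  have : Nontrivial (Fin E.g) := Fin.nontrivial_iff_two_le.2 E.one_lt_g
  obtain ⟨i₀, hi₀⟩ := Finite.exists_min fun i : Fin E.g => E.cylLen [i]
  have hK0 : 0 < K := by linarith
  set β := E.cylLen [i₀] / K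
  have hβ0 : 0 < β := div_pos (cylLen_pos _) hK0
  have hlow : ∀ (v : List (Fin E.g)) (i : Fin E.g), β * E.cylLen v ≤ E.cylLen (v ++ [i]) := by
    intro v i
    have h1 := h.mul_le hK v [i]
    have h2 := mul_le_mul_of_nonneg_left (hi₀ i) (cylLen_pos v).le
    rw [div_mul_eq_mul_div, div_le_iff₀ hK0]
    linarith
  have hup : ∀ (v : List (Fin E.g)) (i : Fin E.g),
      E.cylLen (v ++ [i]) ≤ (1 - β) * E.cylLen v := by
    intro v i
    obtain ⟨j, hj⟩ := exists_ne i
    have hdisj : Disjoint (E.cylinder (v ++ [i])) (E.cylinder (v ++ [j])) := by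
      refine Set.disjoint_left.2 fun x hx hx' => hj ?_
      simpa using (eq_of_mem_cylinder (by simp) hx' hx)
    have h1 : volume (E.cylinder (v ++ [i]) ∪ E.cylinder (v ++ [j])) ≤ volume (E.cylinder v) :=
      measure_mono (union_subset (cylinder_append_subset _ _) (cylinder_append_subset _ _))
    rw [measure_union hdisj (measurableSet_cylinder _), ← ofReal_cylLen, ← ofReal_cylLen,
      ← ofReal_cylLen, ← ENNReal.ofReal_add (cylLen_pos _).le (cylLen_pos _).le,
      ENNReal.ofReal_le_ofReal_iff (cylLen_pos v).le] at h1
    linarith [hlow v j]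
  refine ⟨β, hβ0, ?_, fun v i => ⟨hlow v i, hup v i⟩⟩
  have h1 := hup [] i₀
  rw [cylLen_nil] at h1
  linarith [cylLen_pos ([] ++ [i₀])]

theorem cylLen_le_pow {β : ℝ} (hβ : β < 1) (h : ∀ (v : List (Fin E.g)) (i : Fin E.g),
    E.cylLen (v ++ [i]) ≤ (1 - β) * E.cylLen v) (v : List (Fin E.g)) :
    E.cylLen v ≤ (1 - β) ^ v.length := by
  induction v using List.reverseRecOn with
  | nil => simp [cylLen_nil]
  | append_singleton v i ih =>
    rw [List.length_append, List.length_singleton, pow_succ']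
    exact (h v i).trans (mul_le_mul_of_nonneg_left ih (by linarith))

/-- Bounded distortion makes the branches of the iterates uniformly Lipschitz. -/
theorem HasBoundedDistortion.sub_le_of_mem_cylinder {K : ℝ} (hK : 1 ≤ K)
    (h : E.HasBoundedDistortion K) {v : List (Fin E.g)} {x y : ℝ} (hx : x ∈ E.cylinder v)
    (hy : y ∈ E.cylinder v) (hxy : x ≤ y) :
    E.cylLen v * (E.f^[v.length] y - E.f^[v.length] x) ≤ K * (y - x) := by
  obtain ⟨β, hβ0, hβ1, hβ⟩ := h.exists_child_ratio hK
  have hpow := cylLen_le_pow hβ1 fun v i => (hβ v i).2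
  set a := E.f^[v.length] x
  set b := E.f^[v.length] y
  have ha : a ∈ Ico (0 : ℝ) 1 := iterate_mem (cylinder_subset v hx) _
  have hb : b ∈ Ico (0 : ℝ) 1 := iterate_mem (cylinder_subset v hy) _
  have key : ∀ n : ℕ, E.cylLen v * (b - a - 2 * (1 - β) ^ n) ≤ K * (y - x) := by
    intro n
    set θ := (1 - β) ^ n
    have hθ : 0 < θ := pow_pos (by linarith) n
    set W : Finset (Fin n → Fin E.g) :=
      Finset.univ.filter fun u => E.cylinder (List.ofFn u) ⊆ Icc a b
    have hcover : Ioo (a + θ) (b - θ) ⊆ ⋃ u ∈ W, E.cylinder (List.ofFn u) := by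
      intro z hz
      have hzI : z ∈ Ico (0 : ℝ) 1 := by
        constructor <;> linarith [hz.1, hz.2, ha.1, hb.2]
      obtain ⟨u, hu, hzu⟩ := exists_mem_cylinder (E := E) hzI n
      subst hu
      refine mem_iUnion₂.2 ⟨u.get, ?_, by rwa [List.ofFn_get]⟩
      simp only [W, Finset.mem_filter, Finset.mem_univ, true_and, List.ofFn_get]
      intro z' hz'
      have h1 := (sub_le_cylLen hzu hz').trans (hpow u)
      have h2 := (sub_le_cylLen hz' hzu).trans (hpow u)
      constructor <;> linarith [hz.1, hz.2]
    have h1 : b - a - 2 * θ ≤ ∑ u ∈ W, E.cylLen (List.ofFn u) := by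
      have := (measure_mono (μ := volume) hcover).trans (measure_biUnion_finset_le W _)
      simp only [Real.volume_Ioo, ← ofReal_cylLen] at this
      rw [← ENNReal.ofReal_sum_of_nonneg (fun _ _ => (cylLen_pos _).le),
        ENNReal.ofReal_le_ofReal_iff (Finset.sum_nonneg fun _ _ => (cylLen_pos _).le)] at this
      linarith
    have h2 : ∑ u ∈ W, E.cylLen (v ++ List.ofFn u) ≤ y - x := by
      have hsub : (⋃ u ∈ W, E.cylinder (v ++ List.ofFn u)) ⊆ Icc x y := by
        refine iUnion₂_subset fun u hu z hz => ?_
        have hu' : E.cylinder (List.ofFn u) ⊆ Icc a b := (Finset.mem_filter.1 hu).2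
        obtain ⟨hzv, hTz⟩ := mem_cylinder_append.1 hz
        have hm := strictMonoOn_iterate v
        exact ⟨(hm.le_iff_le hx hzv).1 (hu' hTz).1, (hm.le_iff_le hzv hy).1 (hu' hTz).2⟩
      have := measure_mono (μ := volume) hsub
      rw [measure_biUnion_finset (fun u _ u' _ hne => ?_) fun _ _ => measurableSet_cylinder _,
        Real.volume_Icc] at this
      · simp only [← ofReal_cylLen] at this
        rwa [← ENNReal.ofReal_sum_of_nonneg (fun _ _ => (cylLen_pos _).le),
          ENNReal.ofReal_le_ofReal_iff (by linarith)] at this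
      · refine Set.disjoint_left.2 fun z hz hz' => hne ?_
        have := eq_of_mem_cylinder (by simp) hz hz'
        exact List.ofFn_injective (List.append_cancel_left this)
    calc E.cylLen v * (b - a - 2 * θ)
        ≤ E.cylLen v * ∑ u ∈ W, E.cylLen (List.ofFn u) :=
          mul_le_mul_of_nonneg_left h1 (cylLen_pos v).le
      _ = ∑ u ∈ W, E.cylLen v * E.cylLen (List.ofFn u) := Finset.mul_sum _ _ _
      _ ≤ ∑ u ∈ W, K * E.cylLen (v ++ List.ofFn u) :=
          Finset.sum_le_sum fun u _ => h.mul_le hK v _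
      _ = K * ∑ u ∈ W, E.cylLen (v ++ List.ofFn u) := (Finset.mul_sum _ _ _).symm
      _ ≤ K * (y - x) := mul_le_mul_of_nonneg_left h2 (by linarith)
  have hlim : Tendsto (fun n : ℕ => E.cylLen v * (b - a - 2 * (1 - β) ^ n)) atTop
      (nhds (E.cylLen v * (b - a - 2 * 0))) :=
    Tendsto.const_mul _ (Tendsto.const_sub _ (Tendsto.const_mul _
      (tendsto_pow_atTop_nhds_zero_of_lt_one (by linarith) (by linarith))))
  have := le_of_tendsto' hlim key
  simpa using this

/-- Every point of `[0, 1)` lies in a cylinder of length comparable to `δ`. -/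
theorem exists_cylinder_of_length {β : ℝ} (hβ0 : 0 < β) (hβ1 : β < 1)
    (hβ : ∀ (v : List (Fin E.g)) (i : Fin E.g),
      β * E.cylLen v ≤ E.cylLen (v ++ [i]) ∧ E.cylLen (v ++ [i]) ≤ (1 - β) * E.cylLen v)
    {x δ : ℝ} (hx : x ∈ Ico (0 : ℝ) 1) (hδ0 : 0 < δ) (hδ : δ ≤ 1) :
    ∃ v : List (Fin E.g), x ∈ E.cylinder v ∧ E.cylLen v < δ ∧ β * δ ≤ E.cylLen v := by
  have hex : ∃ n, ∃ v : List (Fin E.g), v.length = n ∧ x ∈ E.cylinder v ∧ E.cylLen v < δ := by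
    obtain ⟨n, hn⟩ := exists_pow_lt_of_lt_one hδ0 (show 1 - β < 1 by linarith)
    obtain ⟨v, rfl, hxv⟩ := exists_mem_cylinder (E := E) hx n
    exact ⟨_, v, rfl, hxv, (cylLen_le_pow hβ1 (fun v i => (hβ v i).2) v).trans_lt hn⟩
  obtain ⟨v, hv, hxv, hvδ⟩ := Nat.find_spec hex
  rcases List.eq_nil_or_concat v with rfl | ⟨u, i, rfl⟩
  · rw [cylLen_nil] at hvδ
    linarith
  rw [List.concat_eq_append] at *
  refine ⟨_, hxv, hvδ, ?_⟩
  have hu : δ ≤ E.cylLen u := by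
    by_contra! hlt
    refine Nat.find_min hex (m := u.length) ?_ ⟨u, rfl, cylinder_append_subset _ _ hxv, hlt⟩
    rw [← hv]
    simp
  nlinarith [(hβ u i).1]

end ExpandingFullShift

/-- A set of positive Hausdorff measure has positive Hausdorff content. -/
theorem exists_pos_le_tsum_ediam {s : ℝ} (hs : 0 < s) {A : Set ℝ}
    (hA : Measure.hausdorffMeasure s A ≠ 0) :
    ∃ η : ℝ, 0 < η ∧ ∀ T : ℕ × ℤ → Set ℝ, A ⊆ ⋃ e, T e →
      ENNReal.ofReal η ≤ ∑' e, Metric.ediam (T e) ^ s := by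
  by_contra! hcon
  apply hA
  rw [Measure.hausdorffMeasure_apply]
  refine ENNReal.iSup_eq_zero.2 fun r => ENNReal.iSup_eq_zero.2 fun hr => ?_
  refine nonpos_iff_eq_zero.1 (ENNReal.le_of_forall_pos_le_add fun ε hε _ => ?_)
  obtain ⟨η, hη0, hη⟩ : ∃ η : ℝ, 0 < η ∧ ENNReal.ofReal η ≤ min (ε : ℝ≥0∞) (r ^ s) := by
    have hpos : 0 < min (ε : ℝ≥0∞) (r ^ s) :=
      lt_min (by exact_mod_cast hε) (ENNReal.rpow_pos_of_nonneg hr hs.le)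
    have hfin : min (ε : ℝ≥0∞) (r ^ s) ≠ ⊤ := ((min_le_left _ _).trans_lt ENNReal.coe_lt_top).ne
    exact ⟨_, ENNReal.toReal_pos hpos.ne' hfin, ENNReal.ofReal_toReal_le⟩
  obtain ⟨T, hT, hsum⟩ := hcon η hη0
  have hsum' := hsum.trans_le hη
  set φ := (Denumerable.eqv (ℕ × ℤ)).symm
  rw [zero_add]
  refine iInf_le_of_le (fun n => T (φ n)) (iInf_le_of_le ?_ (iInf_le_of_le ?_ ?_))
  · exact hT.trans (iUnion_subset fun e => by
      simpa using subset_iUnion (fun n => T (φ n)) (φ.symm e))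
  · intro n
    refine (ENNReal.rpow_le_rpow_iff hs).1 ?_
    exact (ENNReal.le_tsum (φ n)).trans (hsum'.le.trans (min_le_right _ _))
  · refine le_trans ?_ (hsum'.le.trans (min_le_left _ _))
    rw [← φ.tsum_eq]
    exact ENNReal.tsum_le_tsum fun n => iSup_le fun _ => le_rfl

theorem tendsto_card_filter_div_of_succ {P : ℕ → Prop} [DecidablePred P] {r : ℝ}
    (h : Tendsto (fun N : ℕ => (((Finset.range N).filter fun i => P (i + 1)).card : ℝ) / N)
      atTop (nhds r)) :
    Tendsto (fun N : ℕ => (((Finset.range N).filter P).card : ℝ) / N) atTop (nhds r) := by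
  rw [← tendsto_add_atTop_iff_nat 1]
  have hcard : ∀ N : ℕ, (((Finset.range (N + 1)).filter P).card : ℝ) =
      ((Finset.range N).filter fun i => P (i + 1)).card + if P 0 then 1 else 0 := by
    intro N
    rw [← Nat.count_eq_card_filter_range, ← Nat.count_eq_card_filter_range, Nat.count_succ']
    push_cast
    rfl
  have h1 : Tendsto (fun N : ℕ => (N : ℝ) / (N + 1)) atTop (nhds 1) :=
    tendsto_natCast_div_add_atTop 1
  have h2 : Tendsto (fun N : ℕ => (if P 0 then 1 else 0 : ℝ) * (1 / ((N : ℝ) + 1))) atTop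
      (nhds ((if P 0 then 1 else 0 : ℝ) * 0)) :=
    Tendsto.const_mul _ tendsto_one_div_add_atTop_nhds_zero_nat
  have h3 := (h.mul h1).add h2
  simp only [mul_one, mul_zero, add_zero] at h3
  refine h3.congr' ?_
  filter_upwards [eventually_gt_atTop 0] with N hN
  rw [hcard]
  have hN' : (N : ℝ) ≠ 0 := by positivity
  have hN1 : (N : ℝ) + 1 ≠ 0 := by positivity
  push_cast
  field_simp

namespace ExpandingFullShift

variable {E : ExpandingFullShift}

theorem tendsto_freq_of_iterate {m : ℕ} {w : Fin m → Fin E.g} {r : ℝ} (l : ℕ) {x : ℝ}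
    (h : Tendsto (fun n => E.freq w (E.f^[l] x) n) atTop (nhds r)) :
    Tendsto (fun n => E.freq w x n) atTop (nhds r) := by
  induction l generalizing x with
  | zero => exact h
  | succ l ih =>
    rw [Function.iterate_succ_apply] at h
    have h1 := (tendsto_add_atTop_iff_nat m).2 (ih h)
    refine (tendsto_add_atTop_iff_nat m).1 ?_
    simp only [freq, Nat.add_sub_cancel] at h1 ⊢
    refine tendsto_card_filter_div_of_succ
      (P := fun i => ∀ k : Fin m, E.f^[i + k] x ∈ E.branch (w k)) ?_
    have hshift : ∀ (i : ℕ) (k : Fin m), E.f^[i + 1 + k] x = E.f^[i + k] (E.f x) := by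
      intro i k
      rw [← Function.iterate_succ_apply]
      congr 2
      omega
    simpa only [hshift] using h1

theorem freq_eq_of_mem_cylinder {m : ℕ} (w : Fin m → Fin E.g) {v : List (Fin E.g)} {x y : ℝ}
    (hx : x ∈ E.cylinder v) (hy : y ∈ E.cylinder v) :
    E.freq w x v.length = E.freq w y v.length := by
  unfold freq
  congr 3
  refine Finset.filter_congr fun i hi => forall_congr' fun k => ?_
  have hik : i + k < v.length := by
    have := Finset.mem_range.1 hi
    omega
  have hxb := hx.2 _ hik
  have hyb := hy.2 _ hik
  constructor
  · intro h
    rwa [eq_of_mem_branch h hxb]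
  · intro h
    rwa [eq_of_mem_branch h hyb]

/-- The interior of the set of points for which the frequency of `w` is `ε`-close to `r` at some
time after `N`. -/
def closeFreqSet {m : ℕ} (w : Fin m → Fin E.g) (r ε : ℝ) (N : ℕ) : Set ℝ :=
  interior {x | ∃ n ≥ N, |E.freq w x n - r| < ε}

theorem mem_closeFreqSet {m : ℕ} {w : Fin m → Fin E.g} {r ε : ℝ} (hε : 0 < ε) (N : ℕ) {x : ℝ}
    (hx : x ∈ Ico (0 : ℝ) 1) (h0 : x ∉ E.zeroOrbit)
    (h : Tendsto (fun n => E.freq w x n) atTop (nhds r)) : x ∈ closeFreqSet w r ε N := by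
  obtain ⟨n, hn, hnN⟩ := ((Metric.tendsto_nhds.1 h ε hε).and (eventually_ge_atTop N)).exists
  obtain ⟨v, rfl, hxv⟩ := exists_mem_cylinder (E := E) hx n
  refine mem_interior_iff_mem_nhds.2 (mem_of_superset (cylinder_mem_nhds hxv h0) fun y hy => ?_)
  exact ⟨v.length, hnN, freq_eq_of_mem_cylinder w hxv hy ▸ hn⟩

theorem HasBoundedDistortion.hasFullContent_closeFreqSet {K : ℝ} (hK : 1 ≤ K)
    (h : E.HasBoundedDistortion K) {s t : ℝ} (ht0 : 0 ≤ t) (hts : t < s) (hs : s ≤ 1) {m : ℕ}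
    {q : (Fin m → Fin E.g) → ℝ} (hq : ENNReal.ofReal s < dimH (E.Gset m q))
    (w : Fin m → Fin E.g) {ε : ℝ} (hε : 0 < ε) (N : ℕ) :
    HasFullContent t (closeFreqSet w (q w) ε N) := by
  obtain ⟨β, hβ0, hβ1, hβ⟩ := h.exists_child_ratio hK
  have hs0 : 0 < s := ht0.trans_lt hts
  have hK0 : 0 < K := by linarith
  have hdim : ENNReal.ofReal s < dimH (E.Gset m q \ E.zeroOrbit) := by
    have h1 := dimH_mono (subset_sdiff_union (E.Gset m q) E.zeroOrbit)
    rw [dimH_union, dimH_countable countable_zeroOrbit, max_eq_left zero_le] at h1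
    exact hq.trans_le h1
  have hpos : Measure.hausdorffMeasure s (E.Gset m q \ E.zeroOrbit) ≠ 0 := by
    have h1 := hausdorffMeasure_of_lt_dimH (d := s.toNNReal) hdim
    rw [Real.coe_toNNReal s hs0.le] at h1
    simp [h1]
  obtain ⟨η, hη0, hη⟩ := exists_pos_le_tsum_ediam hs0 hpos
  refine hasFullContent_of_le (c := η * (β / (2 * K)) ^ s) ht0 hts hs (by positivity)
    fun d hd S hS => ?_
  have h2 : (0 : ℝ) < 2 ^ d.1 := by positivity
  set x₀ : ℝ := ((d.2 : ℝ) + 1 / 2) / 2 ^ d.1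
  set δ : ℝ := (1 / 2) / 2 ^ d.1
  have hδ0 : 0 < δ := by positivity
  have hδ1 : δ ≤ 1 := by
    rw [div_le_iff₀ h2]
    linarith [one_le_pow₀ (n := d.1) (one_le_two (α := ℝ))]
  have hl : (d.2 : ℝ) / 2 ^ d.1 = x₀ - δ := by
    rw [← sub_div]; congr 1; ring
  have hr : ((d.2 : ℝ) + 1) / 2 ^ d.1 = x₀ + δ := by
    rw [← add_div]; congr 1; ring
  have hx₀ : x₀ ∈ dyIco d := by
    rw [dyIco, hl, hr]
    constructor <;> linarith
  obtain ⟨v, hxv, hvδ, hδv⟩ := exists_cylinder_of_length hβ0 hβ1 hβ (hd hx₀) hδ0 hδ1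
  have hvd : E.cylinder v ⊆ dyIoo d := by
    intro y hy
    rw [dyIoo, hl, hr]
    have h3 := sub_le_cylLen hxv hy
    have h4 := sub_le_cylLen hy hxv
    constructor <;> linarith
  have hv0 := cylLen_pos v
  have hcov : E.Gset m q \ E.zeroOrbit ⊆
      ⋃ e, if e ∈ S then E.f^[v.length] '' (E.cylinder v ∩ dyIco e) else ∅ := by
    rintro y ⟨hy, hy0⟩
    obtain ⟨x, hx, rfl⟩ := surjOn_iterate v hy.1
    have hx0 : x ∉ E.zeroOrbit := fun h' => hy0 (zeroOrbit_of_iterate h' _)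
    have hxU : x ∈ closeFreqSet w (q w) ε N :=
      mem_closeFreqSet hε N (cylinder_subset v hx) hx0 (tendsto_freq_of_iterate _ (hy.2 w))
    obtain ⟨e, he, hxe⟩ := mem_iUnion₂.1 (hS ⟨hxU, hvd hx⟩)
    refine mem_iUnion.2 ⟨e, ?_⟩
    rw [if_pos he]
    exact ⟨x, ⟨hx, hxe⟩, rfl⟩
  have hdiam : ∀ e : ℕ × ℤ, Metric.ediam (E.f^[v.length] '' (E.cylinder v ∩ dyIco e)) ≤
      ENNReal.ofReal (K / E.cylLen v * (2 ^ e.1)⁻¹) := by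
    intro e
    have hlip : ∀ x ∈ E.cylinder v ∩ dyIco e, ∀ y ∈ E.cylinder v ∩ dyIco e, x ≤ y →
        |E.f^[v.length] x - E.f^[v.length] y| ≤ K / E.cylLen v * (2 ^ e.1)⁻¹ := by
      intro x hx y hy hxy
      have h3 := h.sub_le_of_mem_cylinder hK hx.1 hy.1 hxy
      have h4 := (strictMonoOn_iterate v).monotoneOn hx.1 hy.1 hxy
      have h5 := hx.2.1
      have h6 := hy.2.2
      rw [add_div, one_div] at h6
      rw [abs_sub_comm, abs_of_nonneg (by linarith), div_mul_eq_mul_div, le_div_iff₀ hv0, mul_comm]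
      refine h3.trans (mul_le_mul_of_nonneg_left ?_ hK0.le)
      linarith
    refine Metric.ediam_le ?_
    rintro _ ⟨x, hx, rfl⟩ _ ⟨y, hy, rfl⟩
    rw [edist_dist, Real.dist_eq]
    refine ENNReal.ofReal_le_ofReal ?_
    rcases le_total x y with hxy | hxy
    · exact hlip x hx y hy hxy
    · rw [abs_sub_comm]
      exact hlip y hy x hx hxy
  have hweight : ∀ e : ℕ × ℤ, ((2 ^ e.1)⁻¹ : ℝ) ^ s = dyWeight s e := by
    intro e
    rw [dyWeight, Real.inv_rpow (by positivity), Real.rpow_neg (by norm_num),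
      ← Real.rpow_natCast, ← Real.rpow_mul (by norm_num), mul_comm]
  have hsum := (hη _ hcov).trans (ENNReal.tsum_le_tsum
    (g := S.indicator fun e => ENNReal.ofReal ((K / E.cylLen v) ^ s) *
      ENNReal.ofReal (dyWeight s e)) fun e => by
    by_cases he : e ∈ S
    · rw [if_pos he, indicator_of_mem he, ← ENNReal.ofReal_mul (by positivity), ← hweight,
        ← Real.mul_rpow (by positivity) (by positivity),
        ← ENNReal.ofReal_rpow_of_nonneg (by positivity) hs0.le]
      exact ENNReal.rpow_le_rpow (hdiam e) hs0.le
    · simp [he, hs0])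
  rw [← tsum_subtype S (fun e => ENNReal.ofReal ((K / E.cylLen v) ^ s) *
      ENNReal.ofReal (dyWeight s e)), ENNReal.tsum_mul_left, ← dyMeasure_apply] at hsum
  have hmul := mul_le_mul_right hsum (ENNReal.ofReal ((E.cylLen v / K) ^ s))
  rw [← mul_assoc, ← ENNReal.ofReal_mul (by positivity), ← ENNReal.ofReal_mul (by positivity),
    ← Real.mul_rpow (by positivity) (by positivity), div_mul_div_cancel₀ hK0.ne',
    div_self hv0.ne', Real.one_rpow, ENNReal.ofReal_one, one_mul] at hmul
  refine le_trans (ENNReal.ofReal_le_ofReal ?_) hmul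
  rw [← hweight, mul_assoc, ← Real.mul_rpow (by positivity) (by positivity), mul_comm]
  refine mul_le_mul_of_nonneg_right (Real.rpow_le_rpow (by positivity) ?_ hs0.le) hη0.le
  rw [le_div_iff₀ hK0]
  refine le_trans (le_of_eq ?_) hδv
  simp only [δ]
  field_simp

theorem CondII.exists_freq_ne (h : E.CondII) {m : ℕ} (hm : 0 < m) {t : ℝ≥0∞} (ht : t < 1)
    (w : Fin m → Fin E.g) (a : ℝ) :
    ∃ q : (Fin m → Fin E.g) → ℝ, q w ≠ a ∧ t ≤ dimH (E.Gset m q) := by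
  obtain ⟨p, -, hp, hq⟩ := h m hm
  by_cases hpa : p w = a
  · obtain ⟨q, -, hqp, hqt⟩ := hq w t ht
    exact ⟨q, hpa ▸ hqp, hqt⟩
  · exact ⟨p, hpa, hp ▸ ht.le⟩

theorem not_isNormal_of_mem {m : ℕ} {w : Fin m → Fin E.g} {r : ℝ} {x : ℝ}
    (hr : r ≠ E.cylLen (List.ofFn w))
    (hx : ∀ N, x ∈ closeFreqSet w r (|r - E.cylLen (List.ofFn w)| / 2) N) :
    ¬ E.IsNormal m x := by
  intro hnorm
  have hpos : 0 < |r - E.cylLen (List.ofFn w)| / 2 := half_pos (abs_pos.2 (sub_ne_zero.2 hr))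
  obtain ⟨N, hN⟩ := eventually_atTop.1 (Metric.tendsto_nhds.1 (hnorm w) _ hpos)
  obtain ⟨n, hn, hclose⟩ := interior_subset (hx N)
  have h1 : |E.freq w x n - E.cylLen (List.ofFn w)| < _ := hN n hn
  have h2 := abs_sub_le r (E.freq w x n) (E.cylLen (List.ofFn w))
  rw [abs_sub_comm r (E.freq w x n)] at h2
  linarith

end ExpandingFullShift

open ExpandingFullShift in
/-- for a sequence of expanding full-shift maps with bounded distortion
satisfying condition (ii), the set of points of `[0,1)` that are not `m`-normal to any
of the maps for any `m ≥ 1` has Hausdorff dimension `1`. -/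
theorem dimH_not_normal (E : ℕ → ExpandingFullShift)
    (hbd : ∀ i, ∃ K : ℝ, 1 ≤ K ∧ (E i).HasBoundedDistortion K)
    (hii : ∀ i, (E i).CondII) :
    dimH {x ∈ Ico (0:ℝ) 1 | ∀ i, ∀ m : ℕ, 0 < m → ¬ (E i).IsNormal m x} = 1 := by
  refine le_antisymm ((dimH_mono (subset_univ _)).trans Real.dimH_univ.le) ?_
  refine le_of_forall_lt fun a ha => ?_
  obtain ⟨b, hab, hb1⟩ := exists_between ha
  lift b to NNReal using hb1.ne_top
  have ht0 : 0 < (b : ℝ) := ENNReal.coe_pos.1 (pos_of_gt hab)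
  have ht1 : (b : ℝ) < 1 := by exact_mod_cast hb1
  obtain ⟨s, hts, hs1⟩ := exists_between ht1
  obtain ⟨u, hsu, hu1⟩ := exists_between hs1
  have hu : ENNReal.ofReal u < 1 := by rwa [ENNReal.ofReal_lt_one]
  have hsu' : ENNReal.ofReal s < ENNReal.ofReal u :=
    (ENNReal.ofReal_lt_ofReal_iff (by linarith)).2 hsu
  choose K hK hbdK using hbd
  choose q hq hdim using fun i m => (hii i).exists_freq_ne m.succ_pos hu
    (fun _ => (E i).zeroSym) ((E i).cylLen (List.ofFn fun _ : Fin (m + 1) => (E i).zeroSym))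
  set U : ℕ × ℕ × ℕ → Set ℝ := fun e =>
    closeFreqSet (E := E e.1) (fun _ : Fin (e.2.1 + 1) => (E e.1).zeroSym)
      (q e.1 e.2.1 fun _ => (E e.1).zeroSym)
      (|(q e.1 e.2.1 fun _ => (E e.1).zeroSym) -
        (E e.1).cylLen (List.ofFn fun _ : Fin (e.2.1 + 1) => (E e.1).zeroSym)| / 2) e.2.2
  have hdimU := dimH_iInter_of_hasFullContent (U := fun k => U ((Denumerable.eqv _).symm k))
    ht0 ht1.le (fun _ => isOpen_interior) fun k =>
      (hbdK _).hasFullContent_closeFreqSet (hK _) ht0.le hts hs1.le (hsu'.trans_le (hdim _ _)) _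
        (half_pos (abs_pos.2 (sub_ne_zero.2 (hq _ _)))) _
  rw [ENNReal.ofReal_coe_nnreal] at hdimU
  refine hab.trans_le (hdimU.trans (dimH_mono fun x hx => ⟨Ioo_subset_Ico_self hx.1, ?_⟩))
  intro i m hm
  obtain ⟨m, rfl⟩ := Nat.exists_eq_succ_of_ne_zero hm.ne'
  refine not_isNormal_of_mem (hq i m) fun N => ?_
  simpa [U] using mem_iInter.1 hx.2 (Denumerable.eqv _ (i, m, N))
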